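/- The number of spanning-tree decorated rooted quadrangulations with f faces (the root-edge may be any oriented edge of the map) equals 4f / ((f+1)²(f+2)) · multinomial(3f; f, f, f). -/

import Mathlib

/-- A rooted combinatorial map, encoded by permutations of its darts (half-edges):
`sigma` is the counterclockwise rotation of the darts around each vertex, `alpha` is the
fixed-point-free involution exchanging the two darts of each edge, the action generated by
them is transitive (connectedness), and `root` is the marked oriented edge (dart). -/
structure RootedMap where
  nd : ℕ
  sigma : Equiv.Perm (Fin nd)
  alpha : Equiv.Perm (Fin nd)
  alpha_invol : ∀ d, alpha (alpha d) = d
  alpha_fixfree : ∀ d, alpha d ≠ d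
  root : Fin nd
  conn : ∀ d d' : Fin nd,
    ∃ g ∈ Subgroup.closure ({sigma, alpha} : Set (Equiv.Perm (Fin nd))), g d = d'

namespace RootedMap

/-- The number of cycles (orbits) of a permutation, fixed points included. -/
noncomputable def numCycles {n : ℕ} (π : Equiv.Perm (Fin n)) : ℕ :=
  Nat.card (Quot π.SameCycle)

/-- The face permutation of a map. -/
def phi (M : RootedMap) : Equiv.Perm (Fin M.nd) := M.sigma * M.alpha

noncomputable def vertices (M : RootedMap) : ℕ := numCycles M.sigma
def edges (M : RootedMap) : ℕ := M.nd / 2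
noncomputable def faces (M : RootedMap) : ℕ := numCycles M.phi

/-- Planarity (genus 0) via Euler's formula. -/
def Planar (M : RootedMap) : Prop := M.vertices + M.faces = M.edges + 2

/-- Two darts lie on the same vertex. -/
def sameVertex (M : RootedMap) (d d' : Fin M.nd) : Prop := M.sigma.SameCycle d d'

/-- The degree of the face containing a dart `d`: the length of its `phi`-cycle. -/
noncomputable def faceDegreeAt (M : RootedMap) (d : Fin M.nd) : ℕ :=
  Nat.card {d' : Fin M.nd // M.phi.SameCycle d d'}

/-- All faces have degree `q`. -/
def IsQAngulation (M : RootedMap) (q : ℕ) : Prop :=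
  ∀ d : Fin M.nd, M.faceDegreeAt d = q

/-- The degree of the root face (the external face of a map with a boundary). -/
noncomputable def rootFaceDegree (M : RootedMap) : ℕ := M.faceDegreeAt M.root

/-- The boundary (root face) is simple: the face cycle of the root visits every vertex at
most once. -/
def SimpleBoundary (M : RootedMap) : Prop :=
  ∀ d d' : Fin M.nd, M.phi.SameCycle M.root d → M.phi.SameCycle M.root d' →
    M.sameVertex d d' → d = d'

/-- All faces except possibly the root face have degree `q`. -/
def IsQAngulationWithBoundary (M : RootedMap) (q : ℕ) : Prop :=
  ∀ d : Fin M.nd, ¬ M.phi.SameCycle M.root d → M.faceDegreeAt d = q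

/-- `S` (a set of darts, closed under `alpha`) is a subtree of `M`: the corresponding
submap is connected and the number of its vertices exceeds its number of edges by one. -/
def IsTreeSub (M : RootedMap) (S : Finset (Fin M.nd)) : Prop :=
  (∀ d ∈ S, M.alpha d ∈ S) ∧
  (∀ d ∈ S, ∀ d' ∈ S,
    Relation.ReflTransGen
      (fun a b => a ∈ S ∧ b ∈ S ∧ (M.sameVertex a b ∨ b = M.alpha a)) d d') ∧
  Nat.card (Quot (fun a b : {d : Fin M.nd // d ∈ S} => M.sameVertex a.1 b.1))
    = S.card / 2 + 1

/-- `S` is a spanning subtree of `M`: a subtree touching every vertex. -/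
def IsSpanningTree (M : RootedMap) (S : Finset (Fin M.nd)) : Prop :=
  M.IsTreeSub S ∧ ∀ d : Fin M.nd, ∃ d' ∈ S, M.sameVertex d d'

/-- Isomorphism of rooted maps: a root-preserving relabelling of darts commuting with the
structure permutations. -/
def Iso (M M' : RootedMap) : Prop :=
  ∃ f : Fin M.nd ≃ Fin M'.nd,
    (∀ d, f (M.sigma d) = M'.sigma (f d)) ∧
    (∀ d, f (M.alpha d) = M'.alpha (f d)) ∧
    f M.root = M'.root

/-- Isomorphism of decorated rooted maps (the decoration is a set of darts). -/
def DecIso (M M' : RootedMap) (S : Finset (Fin M.nd)) (S' : Finset (Fin M'.nd)) : Prop :=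
  ∃ f : Fin M.nd ≃ Fin M'.nd,
    (∀ d, f (M.sigma d) = M'.sigma (f d)) ∧
    (∀ d, f (M.alpha d) = M'.alpha (f d)) ∧
    f M.root = M'.root ∧
    ∀ d, d ∈ S ↔ f d ∈ S'

end RootedMap


open RootedMap

section OrbitLists

variable {β : Type*}

/-- `a :: l` lists, without repetition and in order, the cycle of `π` through `a`. -/
def OrbitList (π : Equiv.Perm β) (a : β) (l : List β) : Prop :=
  (a :: l).Nodup ∧ (a :: (l ++ [a])).IsChain (fun x y => π x = y)

theorem exists_orbitList [Finite β] (π : Equiv.Perm β) (a : β) : ∃ l, OrbitList π a l := by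
  have hp : a ∈ Function.periodicPts π := π.injective.mem_periodicPts a
  obtain ⟨k, hk⟩ := Nat.exists_eq_succ_of_ne_zero
    (Function.minimalPeriod_pos_of_mem_periodicPts hp).ne'
  have hc : Function.periodicOrbit π a
      = ((a :: (List.range k).map (fun n => π^[n + 1] a) : List β) : Cycle β) := by
    rw [Function.periodicOrbit_def, hk, List.range_succ_eq_map]
    simp [Function.comp_def]
  refine ⟨(List.range k).map (fun n => π^[n + 1] a), ?_, ?_⟩
  · have := Function.nodup_periodicOrbit (f := π) (x := a)
    rw [hc] at this
    exact Cycle.nodup_coe_iff.1 this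
  · have := (Function.periodicOrbit_chain' (fun x y => π x = y) hp).2
      (fun n => (Function.iterate_succ_apply' π n a).symm)
    rw [hc] at this
    exact Cycle.chain_coe_cons _ _ _ |>.1 this

theorem OrbitList.apply_mem {π : Equiv.Perm β} {a x : β} {l : List β} (h : OrbitList π a l)
    (hx : x ∈ a :: l) : π x ∈ a :: l := by
  obtain ⟨s, t, hst⟩ := List.append_of_mem hx
  have hc := h.2
  rw [← List.cons_append, hst] at hc
  cases t with
  | nil =>
    rw [List.append_assoc, List.cons_append, List.isChain_split] at hc
    have := hc.2
    simp at this
    simp [this]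
  | cons y t =>
    rw [List.append_assoc, List.cons_append, List.isChain_split] at hc
    have := hc.2
    simp only [List.cons_append, List.isChain_cons_cons] at this
    rw [hst, this.1]
    simp

theorem mem_of_sameCycle [Finite β] {π : Equiv.Perm β} {C : β → Prop}
    (hC : ∀ x, C x → C (π x)) {x y : β} (h : π.SameCycle x y) (hx : C x) : C y := by
  obtain ⟨n, rfl⟩ := h.exists_nat_pow_eq
  induction n with
  | zero => simpa
  | succ n ih =>
    rw [pow_succ', Equiv.Perm.mul_apply]
    exact hC _ (ih ⟨n, by simp⟩)

theorem sameCycle_of_isChain {π : Equiv.Perm β} {a x : β} {l : List β}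
    (h : (a :: l).IsChain (fun x y => π x = y)) (hx : x ∈ a :: l) : π.SameCycle a x := by
  induction l generalizing a with
  | nil => simp at hx; subst hx; exact Equiv.Perm.SameCycle.rfl
  | cons b l ih =>
    rw [List.isChain_cons_cons] at h
    rcases List.mem_cons.1 hx with rfl | hx
    · exact Equiv.Perm.SameCycle.rfl
    · have := ih h.2 hx
      rw [← h.1] at this
      exact Equiv.Perm.sameCycle_apply_left.1 this

theorem OrbitList.mem_iff [Finite β] {π : Equiv.Perm β} {a x : β} {l : List β}
    (h : OrbitList π a l) : x ∈ a :: l ↔ π.SameCycle a x := by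
  constructor
  · intro hx
    refine sameCycle_of_isChain h.2 ?_
    rw [← List.cons_append]
    exact List.mem_append_left _ hx
  · intro hx
    exact mem_of_sameCycle (C := fun x => x ∈ a :: l) (fun x hx => h.apply_mem hx) hx (by simp)

theorem isChain_apply_unique {π : Equiv.Perm β} {a : β} {l l' : List β}
    (h : (a :: l).IsChain (fun x y => π x = y)) (h' : (a :: l').IsChain (fun x y => π x = y))
    (hl : l.length = l'.length) : l = l' := by
  induction l generalizing a l' with
  | nil => simpa using hl.symm
  | cons b l ih =>
    cases l' with
    | nil => simp at hl
    | cons b' l' =>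
      rw [List.isChain_cons_cons] at h h'
      obtain rfl : b = b' := h.1.symm.trans h'.1
      rw [ih h.2 h'.2 (by simpa using hl)]

theorem OrbitList.unique [Finite β] {π : Equiv.Perm β} {a : β} {l l' : List β}
    (h : OrbitList π a l) (h' : OrbitList π a l') : l = l' := by
  have hp : (a :: l).Perm (a :: l') :=
    (List.perm_ext_iff_of_nodup h.1 h'.1).2 fun x => by rw [h.mem_iff, h'.mem_iff]
  have hl := hp.length_eq
  exact List.append_cancel_right (isChain_apply_unique h.2 h'.2 (by simpa using hl))

/-- The length of the cycle of `π` through `x`. -/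
noncomputable def cycleLength (π : Equiv.Perm β) (x : β) : ℕ :=
  Nat.card {y // π.SameCycle x y}

theorem OrbitList.cycleLength_eq [Finite β] {π : Equiv.Perm β} {a x : β} {l : List β}
    (h : OrbitList π a l) (hx : x ∈ a :: l) : cycleLength π x = l.length + 1 := by
  classical
  have e : {y // π.SameCycle x y} ≃ {y // y ∈ (a :: l).toFinset} :=
    Equiv.subtypeEquivRight fun y => by
      rw [List.mem_toFinset, h.mem_iff]
      have := h.mem_iff.1 hx
      exact ⟨fun q => this.trans q, fun q => this.symm.trans q⟩
  rw [cycleLength, Nat.card_congr e, Nat.card_eq_fintype_card, Fintype.card_coe,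
    List.toFinset_card_of_nodup h.1, List.length_cons]

theorem isChain_congr_left {π ρ : Equiv.Perm β} {a b c : β} {l : List β} (hab : π a = ρ b)
    (hl : ∀ x ∈ l, π x = ρ x) :
    (a :: (l ++ [c])).IsChain (fun x y => π x = y) ↔
      (b :: (l ++ [c])).IsChain (fun x y => ρ x = y) := by
  induction l generalizing a b with
  | nil => simp [hab]
  | cons d l ih =>
    simp only [List.cons_append, List.isChain_cons_cons, hab]
    rw [List.forall_mem_cons] at hl
    exact and_congr_right fun _ => ih hl.1 hl.2

theorem OrbitList.congr {π ρ : Equiv.Perm β} {a : β} {l : List β} (h : OrbitList π a l)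
    (hl : ∀ x ∈ a :: l, π x = ρ x) : OrbitList ρ a l := by
  rw [List.forall_mem_cons] at hl
  exact ⟨h.1, (isChain_congr_left hl.1 hl.2).1 h.2⟩

theorem cycleLength_congr [Finite β] {π ρ : Equiv.Perm β} {x : β}
    (h : ∀ y, π.SameCycle x y → π y = ρ y) : cycleLength π x = cycleLength ρ x := by
  obtain ⟨l, hl⟩ := exists_orbitList π x
  have h' := hl.congr fun y hy => h y (hl.mem_iff.1 hy)
  rw [hl.cycleLength_eq (by simp), h'.cycleLength_eq (by simp)]

theorem orbitList_split [DecidableEq β] {π : Equiv.Perm β} {i j : β} {l₁ l₂ : List β} :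
    OrbitList π i (l₁ ++ j :: l₂) ↔
      (i :: (l₁ ++ j :: l₂)).Nodup ∧ OrbitList (π * Equiv.swap i j) i l₂ ∧
        OrbitList (π * Equiv.swap i j) j l₁ := by
  unfold OrbitList
  refine and_congr_right fun hn => ?_
  have hn' := hn
  simp only [List.nodup_cons, List.mem_append, List.mem_cons, not_or, List.nodup_append] at hn
  obtain ⟨⟨hi1, hij, hi2⟩, hd1, ⟨hj2, hd2⟩, hdd⟩ := hn
  have hj1 : j ∉ l₁ := fun h => hdd j h j (Or.inl rfl) rfl
  have e1 : ∀ x ∈ l₁, π x = (π * Equiv.swap i j) x := fun x hx => by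
    rw [Equiv.Perm.mul_apply, Equiv.swap_apply_of_ne_of_ne]
    · rintro rfl; exact hi1 hx
    · rintro rfl; exact hj1 hx
  have e2 : ∀ x ∈ l₂, π x = (π * Equiv.swap i j) x := fun x hx => by
    rw [Equiv.Perm.mul_apply, Equiv.swap_apply_of_ne_of_ne]
    · rintro rfl; exact hi2 hx
    · rintro rfl; exact hj2 hx
  rw [List.append_assoc, List.cons_append, ← List.cons_append, List.isChain_split,
    List.cons_append, isChain_congr_left (b := j) (by simp) e1,
    isChain_congr_left (b := i) (by simp) e2]
  simp only [List.nodup_cons]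
  tauto

theorem not_sameCycle_mul_swap [Finite β] [DecidableEq β] {π : Equiv.Perm β} {i j : β}
    (hij : i ≠ j) (h : π.SameCycle i j) : ¬ (π * Equiv.swap i j).SameCycle i j := by
  obtain ⟨l, hl⟩ := exists_orbitList π i
  have hj : j ∈ l := (List.mem_cons.1 (hl.mem_iff.2 h)).resolve_left hij.symm
  obtain ⟨l₁, l₂, rfl⟩ := List.append_of_mem hj
  obtain ⟨hn, h2, -⟩ := orbitList_split.1 hl
  rw [← h2.mem_iff]
  simp only [List.nodup_cons, List.mem_append, List.mem_cons, not_or, List.nodup_append] at hn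
  simp only [List.mem_cons, not_or]
  exact ⟨hij.symm, hn.2.2.1.1⟩

theorem OrbitList.merge [Finite β] [DecidableEq β] {π : Equiv.Perm β} {i j : β}
    {l₁ l₂ : List β} (h₂ : OrbitList π i l₂) (h₁ : OrbitList π j l₁) (hij : ¬ π.SameCycle i j) :
    OrbitList (π * Equiv.swap i j) i (l₁ ++ j :: l₂) := by
  refine orbitList_split.2 ⟨?_, ?_, ?_⟩
  · have hd : List.Disjoint (i :: l₂) (j :: l₁) := fun x hx hx' =>
      hij ((h₂.mem_iff.1 hx).trans (h₁.mem_iff.1 hx').symm)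
    have hp : (i :: (l₁ ++ j :: l₂)).Perm ((i :: l₂) ++ (j :: l₁)) := by
      simp only [List.cons_append, List.perm_cons]
      exact (List.perm_append_comm (l₁ := l₁) (l₂ := j :: l₂)).trans (by
        simp only [List.cons_append]
        exact List.perm_middle.symm)
    exact hp.nodup_iff.2 (List.Nodup.append h₂.1 h₁.1 hd)
  · simpa [mul_assoc] using h₂
  · simpa [mul_assoc] using h₁

/-- The number of cycles of a permutation, fixed points included. -/
noncomputable def cycleCount (π : Equiv.Perm β) : ℕ := Nat.card (Quot π.SameCycle)

theorem quot_mk_sameCycle_eq_iff {π : Equiv.Perm β} {x y : β} :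
    Quot.mk π.SameCycle x = Quot.mk π.SameCycle y ↔ π.SameCycle x y :=
  (Equiv.Perm.SameCycle.equivalence π).quot_mk_eq_iff x y

theorem sameCycle_mul_swap_iff [Finite β] [DecidableEq β] {π : Equiv.Perm β} {a b : β}
    (h : ¬ π.SameCycle a b) (x y : β) :
    (π * Equiv.swap a b).SameCycle x y ↔ π.SameCycle x y ∨
      (π.SameCycle a x ∧ π.SameCycle b y) ∨ (π.SameCycle b x ∧ π.SameCycle a y) := by
  obtain ⟨l₂, h₂⟩ := exists_orbitList π a
  obtain ⟨l₁, h₁⟩ := exists_orbitList π b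
  have hm := h₂.merge h₁ h
  have key : ∀ z, (π * Equiv.swap a b).SameCycle a z ↔ π.SameCycle a z ∨ π.SameCycle b z := by
    intro z
    rw [← hm.mem_iff, ← h₁.mem_iff, ← h₂.mem_iff]
    simp only [List.mem_cons, List.mem_append]
    tauto
  have same : ∀ x y, π.SameCycle x y → (π * Equiv.swap a b).SameCycle x y := by
    intro x y hxy
    by_cases hx : π.SameCycle a x ∨ π.SameCycle b x
    · have h1 := (key x).2 hx
      have h2 := (key y).2 (hx.imp (fun q => q.trans hxy) (fun q => q.trans hxy))
      exact h1.symm.trans h2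
    · refine mem_of_sameCycle (C := fun z => (π * Equiv.swap a b).SameCycle x z ∧
        π.SameCycle x z) ?_ hxy ⟨Equiv.Perm.SameCycle.rfl, Equiv.Perm.SameCycle.rfl⟩ |>.1
      rintro z ⟨hz, hz'⟩
      refine ⟨?_, Equiv.Perm.sameCycle_apply_right.2 hz'⟩
      have : (π * Equiv.swap a b) z = π z := by
        rw [Equiv.Perm.mul_apply, Equiv.swap_apply_of_ne_of_ne]
        · rintro rfl; exact hx (Or.inl hz'.symm)
        · rintro rfl; exact hx (Or.inr hz'.symm)
      rw [← this]
      exact Equiv.Perm.sameCycle_apply_right.2 hz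
  constructor
  · intro hxy
    by_cases hx : π.SameCycle a x ∨ π.SameCycle b x
    · have h1 := ((key x).2 hx)
      have hy := (key y).1 (h1.trans hxy)
      rcases hx with hx | hx <;> rcases hy with hy | hy
      · exact Or.inl (hx.symm.trans hy)
      · exact Or.inr (Or.inl ⟨hx, hy⟩)
      · exact Or.inr (Or.inr ⟨hx, hy⟩)
      · exact Or.inl (hx.symm.trans hy)
    · left
      refine mem_of_sameCycle (C := fun z => π.SameCycle x z) ?_ hxy Equiv.Perm.SameCycle.rfl
      intro z hz
      have : (π * Equiv.swap a b) z = π z := by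
        rw [Equiv.Perm.mul_apply, Equiv.swap_apply_of_ne_of_ne]
        · rintro rfl; exact hx (Or.inl hz.symm)
        · rintro rfl; exact hx (Or.inr hz.symm)
      rw [this]
      exact Equiv.Perm.sameCycle_apply_right.2 hz
  · rintro (hxy | ⟨hx, hy⟩ | ⟨hx, hy⟩)
    · exact same x y hxy
    · exact ((key x).2 (Or.inl hx)).symm.trans ((key y).2 (Or.inr hy))
    · exact ((key x).2 (Or.inr hx)).symm.trans ((key y).2 (Or.inl hy))

theorem cycleCount_mul_swap_of_not_sameCycle [Finite β] [DecidableEq β] {π : Equiv.Perm β}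
    {a b : β} (h : ¬ π.SameCycle a b) :
    cycleCount (π * Equiv.swap a b) + 1 = cycleCount π := by
  classical
  set ρ := π * Equiv.swap a b with hρ
  have hiff := sameCycle_mul_swap_iff h
  let f : {q : Quot π.SameCycle // q ≠ Quot.mk _ b} → Quot ρ.SameCycle := fun q =>
    Quot.lift (fun x => Quot.mk ρ.SameCycle x)
      (fun x y hxy => Quot.sound ((hiff x y).2 (Or.inl hxy))) q.1
  have hf : Function.Bijective f := by
    constructor
    · rintro ⟨⟨x⟩, hx⟩ ⟨⟨y⟩, hy⟩ hxy
      have hx' : ¬ π.SameCycle x b := fun q => hx (Quot.sound q)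
      have hy' : ¬ π.SameCycle y b := fun q => hy (Quot.sound q)
      have := (hiff x y).1 (quot_mk_sameCycle_eq_iff.1 hxy)
      rcases this with q | ⟨-, q⟩ | ⟨q, -⟩
      · exact Subtype.ext (Quot.sound q)
      · exact absurd q.symm hy'
      · exact absurd q.symm hx'
    · rintro ⟨x⟩
      by_cases hx : π.SameCycle x b
      · refine ⟨⟨Quot.mk _ a, fun q => h (quot_mk_sameCycle_eq_iff.1 q)⟩, ?_⟩
        exact Quot.sound ((hiff a x).2 (Or.inr (Or.inl ⟨Equiv.Perm.SameCycle.rfl, hx.symm⟩)))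
      · exact ⟨⟨Quot.mk _ x, fun q => hx (quot_mk_sameCycle_eq_iff.1 q)⟩, rfl⟩
  have hc := Nat.card_congr (Equiv.ofBijective f hf)
  have : Fintype (Quot π.SameCycle) := Fintype.ofFinite _
  have h1 : 0 < Fintype.card (Quot π.SameCycle) := Fintype.card_pos_iff.2 ⟨Quot.mk _ b⟩
  rw [cycleCount, cycleCount, ← hc, Nat.card_eq_fintype_card, Nat.card_eq_fintype_card,
    Fintype.card_subtype_compl, Fintype.card_subtype_eq]
  omega

theorem cycleCount_mul_swap_of_sameCycle [Finite β] [DecidableEq β] {π : Equiv.Perm β}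
    {a b : β} (hab : a ≠ b) (h : π.SameCycle a b) :
    cycleCount (π * Equiv.swap a b) = cycleCount π + 1 := by
  have := cycleCount_mul_swap_of_not_sameCycle (not_sameCycle_mul_swap hab h)
  simpa [mul_assoc] using this.symm

end OrbitLists

section Noncrossing

variable {β : Type*}

theorem involution_apply_apply {m : Equiv.Perm β} (hm : m * m = 1) (x : β) : m (m x) = x := by
  rw [← Equiv.Perm.mul_apply, hm, Equiv.Perm.one_apply]

variable [DecidableEq β]

theorem involution_mul_swap_apply {m : Equiv.Perm β} (hm : m * m = 1) (i x : β) :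
    (m * Equiv.swap i (m i)) x = if x = i ∨ x = m i then x else m x := by
  rw [Equiv.Perm.mul_apply, Equiv.swap_apply_def]
  split_ifs with h1 h2 h3 h4 h5 <;> simp_all [involution_apply_apply hm]

theorem involution_mul_swap_sq {m : Equiv.Perm β} (hm : m * m = 1) (i : β) :
    (m * Equiv.swap i (m i)) * (m * Equiv.swap i (m i)) = 1 := by
  ext x
  rw [Equiv.Perm.mul_apply, involution_mul_swap_apply hm, involution_mul_swap_apply hm]
  have := involution_apply_apply hm
  by_cases h : x = i ∨ x = m i
  · simp [h]
  · have h' : ¬ (m x = i ∨ m x = m i) := by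
      rintro (q | q)
      · exact h (Or.inr (by rw [← q, this]))
      · exact h (Or.inl (m.injective q))
    simp only [h, h', if_false, this, Equiv.Perm.one_apply]

theorem swap_mul_eq_mul_swap (ψ : Equiv.Perm β) (i k : β) :
    Equiv.swap i k * ψ = ψ * Equiv.swap (ψ⁻¹ i) (ψ⁻¹ k) := by
  rw [Equiv.swap_apply_apply]
  simp [mul_assoc]

theorem isChain_swap_mul {ψ : Equiv.Perm β} {i k a : β} {l : List β}
    (h : (a :: (l ++ [k])).IsChain (fun x y => ψ x = y)) (hi : i ∉ l) (hk : k ∉ l) :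
    (a :: (l ++ [i])).IsChain (fun x y => (Equiv.swap i k * ψ) x = y) := by
  induction l generalizing a with
  | nil =>
    simp only [List.nil_append, List.isChain_cons_cons, Equiv.Perm.mul_apply] at h ⊢
    rw [h.1]
    simp
  | cons b l ih =>
    simp only [List.cons_append, List.isChain_cons_cons, Equiv.Perm.mul_apply, List.mem_cons,
      not_or] at h hi hk ⊢
    rw [h.1]
    exact ⟨Equiv.swap_apply_of_ne_of_ne (Ne.symm hi.1) (Ne.symm hk.1), ih h.2 hi.2 hk.2⟩

variable [Fintype β]

/-- An involution `m` is noncrossing with respect to `τ` if multiplying `τ` by each of its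
transpositions creates a new cycle. -/
def Noncrossing (τ m : Equiv.Perm β) : Prop :=
  2 * cycleCount (τ * m) = 2 * cycleCount τ + m.support.card

theorem card_support_involution_mul_swap {m : Equiv.Perm β} (hm : m * m = 1) {i : β}
    (hi : m i ≠ i) :
    (m * Equiv.swap i (m i)).support.card + 2 = m.support.card := by
  have hs : m.support = insert i (insert (m i) (m * Equiv.swap i (m i)).support) := by
    ext x
    rw [Finset.mem_insert, Finset.mem_insert, Equiv.Perm.mem_support, Equiv.Perm.mem_support,
      involution_mul_swap_apply hm]
    by_cases h : x = i ∨ x = m i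
    · rcases h with rfl | rfl
      · simp [hi]
      · simp [involution_apply_apply hm, hi.symm]
    · simp only [h, if_false]
      tauto
  rw [hs, Finset.card_insert_of_notMem, Finset.card_insert_of_notMem]
  · rw [Equiv.Perm.mem_support, involution_mul_swap_apply hm]; simp
  · rw [Finset.mem_insert, Equiv.Perm.mem_support, involution_mul_swap_apply hm]
    simpa using hi.symm

theorem even_card_support_involution {m : Equiv.Perm β} (hm : m * m = 1) :
    Even m.support.card := by
  induction h : m.support.card using Nat.strong_induction_on generalizing m with
  | _ n ih =>
    by_cases h1 : m = 1
    · subst h1; simp at h; simp [← h]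
    · obtain ⟨i, hi⟩ : ∃ i, m i ≠ i := by
        by_contra! hc
        exact h1 (Equiv.ext hc)
      have hc := card_support_involution_mul_swap hm hi
      have := ih _ (by omega) (involution_mul_swap_sq hm i) rfl
      rw [← h, ← hc]
      exact this.add even_two

theorem cycleCount_mul_swap_le (π : Equiv.Perm β) (a b : β) :
    cycleCount (π * Equiv.swap a b) ≤ cycleCount π + 1 := by
  by_cases hab : a = b
  · subst hab; simp [Equiv.swap_self, ← Equiv.Perm.one_def]
  by_cases h : π.SameCycle a b
  · exact (cycleCount_mul_swap_of_sameCycle hab h).le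
  · have := cycleCount_mul_swap_of_not_sameCycle h
    omega

theorem cycleCount_mul_involution_le (τ : Equiv.Perm β) {m : Equiv.Perm β} (hm : m * m = 1) :
    2 * cycleCount (τ * m) ≤ 2 * cycleCount τ + m.support.card := by
  induction h : m.support.card using Nat.strong_induction_on generalizing m with
  | _ n ih =>
    by_cases h1 : m = 1
    · subst h1; simp
    · obtain ⟨i, hi⟩ : ∃ i, m i ≠ i := by
        by_contra! hc
        exact h1 (Equiv.ext hc)
      have hc := card_support_involution_mul_swap hm hi
      have h2 := ih _ (by omega) (involution_mul_swap_sq hm i) rfl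
      have h3 := cycleCount_mul_swap_le (τ * (m * Equiv.swap i (m i))) i (m i)
      have h4 : τ * (m * Equiv.swap i (m i)) * Equiv.swap i (m i) = τ * m := by
        simp [mul_assoc]
      rw [h4] at h3
      omega

theorem noncrossing_iff_mul_swap (τ : Equiv.Perm β) {m : Equiv.Perm β} (hm : m * m = 1) {i : β}
    (hi : m i ≠ i) : Noncrossing τ m ↔ Noncrossing τ (m * Equiv.swap i (m i)) ∧
      (τ * (m * Equiv.swap i (m i))).SameCycle i (m i) := by
  have hc := card_support_involution_mul_swap hm hi
  have h2 := cycleCount_mul_involution_le τ (involution_mul_swap_sq hm i)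
  have h4 : τ * (m * Equiv.swap i (m i)) * Equiv.swap i (m i) = τ * m := by
    simp [mul_assoc]
  unfold Noncrossing
  by_cases hs : (τ * (m * Equiv.swap i (m i))).SameCycle i (m i)
  · have h3 := cycleCount_mul_swap_of_sameCycle hi.symm hs
    rw [h4] at h3
    simp only [hs, and_true]
    omega
  · have h3 := cycleCount_mul_swap_of_not_sameCycle hs
    rw [h4] at h3
    simp only [hs, and_false, iff_false]
    omega

theorem cycleCount_swap_mul {ψ : Equiv.Perm β} {i k : β} (hi : ψ i = i) (hik : i ≠ k) :
    cycleCount (Equiv.swap i k * ψ) + 1 = cycleCount ψ := by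
  rw [swap_mul_eq_mul_swap]
  have h1 : ψ⁻¹ i = i := by rw [Equiv.Perm.inv_eq_iff_eq, hi]
  rw [h1]
  apply cycleCount_mul_swap_of_not_sameCycle
  intro h
  have := h.eq_of_left hi
  rw [eq_comm, Equiv.Perm.inv_eq_iff_eq, hi] at this
  exact hik this.symm

theorem noncrossing_swap_mul {τ m : Equiv.Perm β} {i k : β} (hi : τ i = i) (hik : i ≠ k)
    (hm : m i = i) : Noncrossing (Equiv.swap i k * τ) m ↔ Noncrossing τ m := by
  have h1 := cycleCount_swap_mul hi hik
  have h2 := cycleCount_swap_mul (ψ := τ * m) (by rw [Equiv.Perm.mul_apply, hm, hi]) hik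
  unfold Noncrossing
  rw [mul_assoc]
  omega

theorem OrbitList.swap_mul {ψ : Equiv.Perm β} {i k : β} {l : List β} (hi : ψ i = i)
    (hik : i ≠ k) (h : OrbitList ψ k l) : OrbitList (Equiv.swap i k * ψ) i (k :: l) := by
  have hil : i ∉ k :: l := fun q => by
    have := (h.mem_iff.1 q).symm.eq_of_left hi
    exact hik this
  refine ⟨List.nodup_cons.2 ⟨hil, h.1⟩, ?_⟩
  rw [List.cons_append, List.isChain_cons_cons]
  refine ⟨by simp [hi], isChain_swap_mul h.2 (fun q => hil (List.mem_cons_of_mem _ q)) ?_⟩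
  exact (List.nodup_cons.1 h.1).1

theorem orbitList_swap_mul_iff {ψ : Equiv.Perm β} {i k : β} {l : List β} (hi : ψ i = i)
    (hik : i ≠ k) :
    OrbitList (Equiv.swap i k * ψ) i l ↔ ∃ l', l = k :: l' ∧ OrbitList ψ k l' := by
  constructor
  · intro h
    obtain ⟨l', hl'⟩ := exists_orbitList ψ k
    exact ⟨l', h.unique (hl'.swap_mul hi hik), hl'⟩
  · rintro ⟨l', rfl, h⟩
    exact h.swap_mul hi hik

theorem cycleLength_swap_mul {ψ : Equiv.Perm β} {i k x : β} (hx : x ≠ i) (hi : ψ i = i)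
    (hxk : ¬ ψ.SameCycle k x) :
    cycleLength (Equiv.swap i k * ψ) x = cycleLength ψ x := by
  refine (cycleLength_congr fun y hy => ?_).symm
  rw [Equiv.Perm.mul_apply, Equiv.swap_apply_of_ne_of_ne]
  · intro h
    have h1 : ψ.SameCycle y i := h ▸ Equiv.Perm.sameCycle_apply_right.2 Equiv.Perm.SameCycle.rfl
    exact hx ((hy.trans h1).eq_of_right hi)
  · intro h
    have h1 : ψ.SameCycle y k := h ▸ Equiv.Perm.sameCycle_apply_right.2 Equiv.Perm.SameCycle.rfl
    exact hxk (hy.trans h1).symm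

theorem cycleLength_mul_swap {π : Equiv.Perm β} {i j x : β} (hi : ¬ π.SameCycle i x)
    (hj : ¬ π.SameCycle j x) : cycleLength (π * Equiv.swap i j) x = cycleLength π x := by
  refine (cycleLength_congr fun y hy => ?_).symm
  rw [Equiv.Perm.mul_apply, Equiv.swap_apply_of_ne_of_ne]
  · rintro rfl; exact hi hy.symm
  · rintro rfl; exact hj hy.symm

end Noncrossing

section Stages

variable {N : ℕ}

/-- The cycle `t → t - 1 → ⋯ → 0 → t`, as a permutation of `{0, …, N}`. -/
def downCycle (N : ℕ) : ℕ → Equiv.Perm (Fin (N + 1))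
  | 0 => 1
  | t + 1 => Equiv.swap (Fin.ofNat (N + 1) (t + 1)) (Fin.ofNat (N + 1) t) * downCycle N t

theorem ofNat_val {t : ℕ} (ht : t ≤ N) : (Fin.ofNat (N + 1) t).val = t :=
  Nat.mod_eq_of_lt (by omega)

theorem ofNat_succ_ne {t : ℕ} (ht : t + 1 ≤ N) :
    Fin.ofNat (N + 1) (t + 1) ≠ Fin.ofNat (N + 1) t := fun h => by
  have := congrArg Fin.val h
  rw [ofNat_val ht, ofNat_val (by omega)] at this
  omega

theorem downCycle_apply_of_lt {t : ℕ} (ht : t ≤ N) {x : Fin (N + 1)} (hx : t < x.val) :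
    downCycle N t x = x := by
  induction t with
  | zero => rfl
  | succ t ih =>
    rw [downCycle, Equiv.Perm.mul_apply, ih (by omega) (by omega),
      Equiv.swap_apply_of_ne_of_ne]
    · rintro rfl; rw [ofNat_val ht] at hx; omega
    · rintro rfl; rw [ofNat_val (by omega)] at hx; omega

/-- `m` is a noncrossing involution of `{0, …, t}` and `t :: l` is the cycle of
`downCycle N t * m` through `t`. -/
structure IsStage (N t : ℕ) (m : Equiv.Perm (Fin (N + 1))) (l : List (Fin (N + 1))) : Prop where
  sq : m * m = 1
  fix : ∀ x : Fin (N + 1), t < x.val → m x = x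
  noncrossing : Noncrossing (downCycle N t) m
  orbit : OrbitList (downCycle N t * m) (Fin.ofNat (N + 1) t) l

theorem IsStage.apply_of_lt {t : ℕ} {m : Equiv.Perm (Fin (N + 1))} {l : List (Fin (N + 1))}
    (h : IsStage N t m l) (ht : t ≤ N) {x : Fin (N + 1)} (hx : t < x.val) :
    (downCycle N t * m) x = x := by
  rw [Equiv.Perm.mul_apply, h.fix x hx, downCycle_apply_of_lt ht hx]

theorem IsStage.le_of_mem {t : ℕ} {m : Equiv.Perm (Fin (N + 1))} {l : List (Fin (N + 1))}
    (h : IsStage N t m l) (ht : t ≤ N) {x : Fin (N + 1)} (hx : x ∈ Fin.ofNat (N + 1) t :: l) :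
    x.val ≤ t := by
  by_contra! hlt
  have := (h.orbit.mem_iff.1 hx).eq_of_right (h.apply_of_lt ht hlt)
  rw [← this, ofNat_val ht] at hlt
  omega

theorem isStage_succ_iff_of_fixed {t : ℕ} (ht : t + 1 ≤ N) {m : Equiv.Perm (Fin (N + 1))}
    {l : List (Fin (N + 1))} (hm : m (Fin.ofNat (N + 1) (t + 1)) = Fin.ofNat (N + 1) (t + 1)) :
    IsStage N (t + 1) m l ↔ ∃ l', l = Fin.ofNat (N + 1) t :: l' ∧ IsStage N t m l' := by
  have hne := ofNat_succ_ne ht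
  have hfix := downCycle_apply_of_lt (t := t) (x := Fin.ofNat (N + 1) (t + 1)) (by omega)
    (by rw [ofNat_val ht]; omega)
  have hnc := noncrossing_swap_mul hfix hne hm
  have horb := orbitList_swap_mul_iff (ψ := downCycle N t * m) (l := l)
    (by rw [Equiv.Perm.mul_apply, hm, hfix]) hne
  have hf : (∀ x : Fin (N + 1), t + 1 < x.val → m x = x) ↔
      (∀ x : Fin (N + 1), t < x.val → m x = x) := by
    refine ⟨fun h x hx => ?_, fun h x hx => h x (by omega)⟩
    by_cases hx' : t + 1 < x.val
    · exact h x hx'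
    · have : x = Fin.ofNat (N + 1) (t + 1) := Fin.ext (by rw [ofNat_val ht]; omega)
      rw [this, hm]
  constructor
  · rintro ⟨h1, h2, h3, h4⟩
    rw [downCycle, mul_assoc] at h4
    obtain ⟨l', rfl, h5⟩ := horb.1 h4
    exact ⟨l', rfl, h1, hf.1 h2, hnc.1 h3, h5⟩
  · rintro ⟨l', rfl, h1, h2, h3, h4⟩
    refine ⟨h1, hf.2 h2, hnc.2 h3, ?_⟩
    rw [downCycle, mul_assoc]
    exact horb.2 ⟨l', rfl, h4⟩

theorem IsStage.add_chord {t : ℕ} (ht : t + 1 ≤ N) {m : Equiv.Perm (Fin (N + 1))} {j : Fin (N + 1)}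
    {l l₁ l₂ : List (Fin (N + 1))} (h : IsStage N t m l)
    (hl : Fin.ofNat (N + 1) t :: l = l₁ ++ j :: l₂) (hj : m j = j) :
    j ≠ Fin.ofNat (N + 1) (t + 1) ∧
    (m * Equiv.swap (Fin.ofNat (N + 1) (t + 1)) j) (Fin.ofNat (N + 1) (t + 1)) = j ∧
    IsStage N (t + 1) (m * Equiv.swap (Fin.ofNat (N + 1) (t + 1)) j) l₂ ∧
    OrbitList (downCycle N (t + 1) * (m * Equiv.swap (Fin.ofNat (N + 1) (t + 1)) j)) j l₁ := by
  have hji : j ≠ Fin.ofNat (N + 1) (t + 1) := by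
    rintro rfl
    have := h.le_of_mem (by omega) (x := Fin.ofNat (N + 1) (t + 1)) (by rw [hl]; simp)
    rw [ofNat_val ht] at this
    omega
  have hi : m (Fin.ofNat (N + 1) (t + 1)) = Fin.ofNat (N + 1) (t + 1) :=
    h.fix _ (by rw [ofNat_val ht]; omega)
  have h' : IsStage N (t + 1) m (Fin.ofNat (N + 1) t :: l) :=
    (isStage_succ_iff_of_fixed ht hi).2 ⟨l, rfl, h⟩
  set i := Fin.ofNat (N + 1) (t + 1) with hidef
  have horb := h'.orbit
  rw [← hidef, hl] at horb
  obtain ⟨-, h2, h1⟩ := orbitList_split.1 horb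
  rw [mul_assoc] at h1 h2
  have hmi : (m * Equiv.swap i j) i = j := by simp [hj]
  have hcomm : m * Equiv.swap i j = Equiv.swap i j * m := by
    rw [swap_mul_eq_mul_swap, Equiv.Perm.inv_eq_iff_eq.2 hi.symm,
      Equiv.Perm.inv_eq_iff_eq.2 hj.symm]
  have hsq : m * Equiv.swap i j * (m * Equiv.swap i j) = 1 := by
    nth_rewrite 1 [hcomm]
    rw [mul_assoc, ← mul_assoc m m, h'.sq, one_mul, Equiv.swap_mul_self]
  refine ⟨hji, hmi, ⟨hsq, fun x hx => ?_, ?_, h2⟩, h1⟩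
  · rw [Equiv.Perm.mul_apply, Equiv.swap_apply_of_ne_of_ne]
    · exact h'.fix x hx
    · rintro rfl; rw [ofNat_val ht] at hx; omega
    · rintro rfl
      have := h.le_of_mem (by omega) (x := x) (by rw [hl]; simp)
      omega
  · rw [noncrossing_iff_mul_swap _ hsq (i := i) (by rw [hmi]; exact hji), hmi]
    rw [mul_assoc, Equiv.swap_mul_self, mul_one]
    refine ⟨h'.noncrossing, horb.mem_iff.1 (by simp)⟩

theorem IsStage.remove_chord {t : ℕ} (ht : t + 1 ≤ N) {m : Equiv.Perm (Fin (N + 1))}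
    {i j : Fin (N + 1)} {l₂ : List (Fin (N + 1))} (h : IsStage N (t + 1) m l₂)
    (hidef : i = Fin.ofNat (N + 1) (t + 1)) (hmi : m i = j) (hji : j ≠ i) :
    ∃ l₁ l, Fin.ofNat (N + 1) t :: l = l₁ ++ j :: l₂ ∧ IsStage N t (m * Equiv.swap i j) l ∧
      OrbitList (downCycle N (t + 1) * m) j l₁ ∧
      ∀ x, (m * Equiv.swap i j) x = if x = i ∨ x = j then x else m x := by
  have happ := involution_mul_swap_apply h.sq i
  have hsq := involution_mul_swap_sq h.sq i
  have hnc := (noncrossing_iff_mul_swap _ h.sq (by rw [hmi]; exact hji)).1 h.noncrossing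
  rw [hmi] at happ hsq hnc
  have hfi : (m * Equiv.swap i j) i = i := by rw [happ]; simp
  obtain ⟨l, hl⟩ := exists_orbitList (downCycle N (t + 1) * (m * Equiv.swap i j)) i
  have hst : IsStage N (t + 1) (m * Equiv.swap i j) l := by
    refine ⟨hsq, fun x hx => ?_, hnc.1, hidef ▸ hl⟩
    rw [happ, h.fix x hx, ite_self]
  have hjl : j ∈ l := (List.mem_cons.1 (hl.mem_iff.2 hnc.2)).resolve_left hji
  obtain ⟨l', hl', hst'⟩ := (isStage_succ_iff_of_fixed ht (hidef ▸ hfi)).1 hst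
  obtain ⟨l₁, l₃, hlj⟩ := List.append_of_mem hjl
  rw [hlj] at hl
  obtain ⟨-, h2, h1⟩ := orbitList_split.1 hl
  have hback : downCycle N (t + 1) * (m * Equiv.swap i j) * Equiv.swap i j
      = downCycle N (t + 1) * m := by simp [mul_assoc]
  rw [hback] at h1 h2
  have horb := h.orbit
  rw [← hidef] at horb
  obtain rfl := horb.unique h2
  exact ⟨l₁, l', by rw [← hl', hlj], hst', h1, happ⟩

theorem IsStage.cycleLength_add_chord {t : ℕ} (ht : t + 1 ≤ N) {m : Equiv.Perm (Fin (N + 1))}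
    {i j x : Fin (N + 1)} {l : List (Fin (N + 1))} (h : IsStage N t m l)
    (hidef : i = Fin.ofNat (N + 1) (t + 1))
    (hj : j ∈ Fin.ofNat (N + 1) t :: l) (hxi : x ≠ i) (hx : x ∉ Fin.ofNat (N + 1) t :: l) :
    cycleLength (downCycle N (t + 1) * (m * Equiv.swap i j)) x
      = cycleLength (downCycle N t * m) x := by
  have hi : m i = i := h.fix _ (by rw [hidef, ofNat_val ht]; omega)
  have h' : IsStage N (t + 1) m (Fin.ofNat (N + 1) t :: l) :=
    (isStage_succ_iff_of_fixed ht (hidef ▸ hi)).2 ⟨l, rfl, h⟩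
  have horb := h'.orbit
  rw [← hidef] at horb
  have hix : ¬ (downCycle N (t + 1) * m).SameCycle i x := fun q => by
    rcases List.mem_cons.1 (horb.mem_iff.2 q) with q | q
    · exact hxi q
    · exact hx q
  have hjx : ¬ (downCycle N (t + 1) * m).SameCycle j x := fun q =>
    hix ((horb.mem_iff.1 (List.mem_cons_of_mem _ hj)).trans q)
  rw [← mul_assoc, cycleLength_mul_swap hix hjx, downCycle, mul_assoc, ← hidef]
  refine cycleLength_swap_mul hxi ?_ ?_
  · rw [Equiv.Perm.mul_apply, hi, downCycle_apply_of_lt (by omega)]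
    rw [hidef, ofNat_val ht]
    omega
  · rwa [← h.orbit.mem_iff]

theorem IsStage.cycleLength_fixed {t : ℕ} (ht : t + 1 ≤ N) {m : Equiv.Perm (Fin (N + 1))}
    {x : Fin (N + 1)} {l : List (Fin (N + 1))} (h : IsStage N t m l)
    (hxi : x ≠ Fin.ofNat (N + 1) (t + 1)) (hx : x ∉ Fin.ofNat (N + 1) t :: l) :
    cycleLength (downCycle N (t + 1) * m) x = cycleLength (downCycle N t * m) x := by
  have hi : m (Fin.ofNat (N + 1) (t + 1)) = Fin.ofNat (N + 1) (t + 1) :=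
    h.fix _ (by rw [ofNat_val ht]; omega)
  rw [downCycle, mul_assoc]
  refine cycleLength_swap_mul hxi ?_ ?_
  · rw [Equiv.Perm.mul_apply, hi, downCycle_apply_of_lt (by omega)]
    rw [ofNat_val ht]
    omega
  · rwa [← h.orbit.mem_iff]

end Stages

section Recursion

variable {N : ℕ}

theorem eq_of_append_cons_eq_of_length {γ : Type*} {l₁ l₂ l₃ l₄ : List γ} {a b : γ}
    (h : l₁ ++ a :: l₂ = l₃ ++ b :: l₄) (hl : l₁.length = l₃.length) : a = b :=
  (List.cons.inj (List.append_inj h hl).2).1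

theorem eq_of_append_cons_eq_of_first {γ : Type*} {p : γ → Prop} {l₁ l₂ l₃ l₄ : List γ} {a b : γ}
    (h : l₁ ++ a :: l₂ = l₃ ++ b :: l₄) (h₁ : ∀ x ∈ l₁, ¬ p x) (h₃ : ∀ x ∈ l₃, ¬ p x)
    (ha : p a) (hb : p b) : a = b := by
  induction l₁ generalizing l₃ with
  | nil =>
    cases l₃ with
    | nil => simpa using (List.cons.inj h).1
    | cons c l₃ =>
      obtain ⟨rfl, -⟩ := List.cons.inj h
      exact absurd ha (h₃ a (by simp))
  | cons c l₁ ih =>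
    cases l₃ with
    | nil =>
      obtain ⟨rfl, -⟩ := List.cons.inj h
      exact absurd hb (h₁ c (by simp))
    | cons d l₃ =>
      rw [List.forall_mem_cons] at h₁ h₃
      exact ih (List.cons.inj h).2 h₁.2 h₃.2

theorem isStage_zero_iff {m : Equiv.Perm (Fin (N + 1))} {l : List (Fin (N + 1))} :
    IsStage N 0 m l ↔ m = 1 ∧ l = [] := by
  have h0 : OrbitList (1 : Equiv.Perm (Fin (N + 1))) (Fin.ofNat (N + 1) 0) [] := by
    simp [OrbitList]
  constructor
  · intro h
    have hm : m = 1 := by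
      ext x
      by_cases hx : 0 < x.val
      · rw [h.fix x hx]; rfl
      · by_contra hne
        have hx0 : 0 < (m x).val := by
          by_contra h0
          exact hne (by simp only [Equiv.Perm.one_apply]; omega)
        have := h.fix _ hx0
        exact hne (congrArg Fin.val (m.injective this))
    subst hm
    have := h.orbit
    rw [downCycle, mul_one] at this
    exact ⟨rfl, this.unique h0⟩
  · rintro ⟨rfl, rfl⟩
    refine ⟨one_mul 1, fun x _ => rfl, by simp [Noncrossing, downCycle], ?_⟩
    rw [downCycle, mul_one]
    exact h0

/-- Noncrossing involutions `m` of `{0, …, t}` such that the cycle of `downCycle N t * m`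
through `t` has the length of `L`, its elements flagged by `true` in `L` being fixed by `m`, and
all its other cycles have length four. -/
def quadMatchings (N t : ℕ) (L : List Bool) : Set (Equiv.Perm (Fin (N + 1))) :=
  {m | ∃ l, IsStage N t m l ∧
    List.Forall₂ (fun b x => b = true → m x = x) L (Fin.ofNat (N + 1) t :: l) ∧
    ∀ x : Fin (N + 1), x.val ≤ t → x ∉ Fin.ofNat (N + 1) t :: l →
      cycleLength (downCycle N t * m) x = 4}

theorem ncard_quadMatchings_zero (L : List Bool) :
    (quadMatchings N 0 L).ncard = if L.length = 1 then 1 else 0 := by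
  have hval : ∀ x : Fin (N + 1), x.val ≤ 0 → x ∈ [Fin.ofNat (N + 1) 0] := fun x hx => by
    simp only [List.mem_singleton]
    exact Fin.ext (by simpa using hx)
  split_ifs with hL
  · obtain ⟨b, rfl⟩ := List.length_eq_one_iff.1 hL
    rw [Set.ncard_eq_one]
    refine ⟨1, Set.ext fun m => ⟨?_, ?_⟩⟩
    · rintro ⟨l, h, -⟩
      exact (isStage_zero_iff.1 h).1
    · rintro rfl
      exact ⟨[], isStage_zero_iff.2 ⟨rfl, rfl⟩, by simp, fun x hx hx' => absurd (hval x hx) hx'⟩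
  · rw [Set.ncard_eq_zero, Set.eq_empty_iff_forall_notMem]
    rintro m ⟨l, h, h2, -⟩
    rw [(isStage_zero_iff.1 h).2] at h2
    exact hL h2.length_eq

theorem quadMatchings_nil (t : ℕ) : quadMatchings N t [] = ∅ := by
  rw [Set.eq_empty_iff_forall_notMem]
  rintro m ⟨l, -, h, -⟩
  cases h

theorem mem_quadMatchings_succ_of_fixed {t : ℕ} (ht : t + 1 ≤ N) {m : Equiv.Perm (Fin (N + 1))}
    (hm : m (Fin.ofNat (N + 1) (t + 1)) = Fin.ofNat (N + 1) (t + 1)) (b : Bool) (L : List Bool) :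
    m ∈ quadMatchings N (t + 1) (b :: L) ↔ m ∈ quadMatchings N t L := by
  constructor
  · rintro ⟨l, h, hL, hd⟩
    obtain ⟨l', rfl, h'⟩ := (isStage_succ_iff_of_fixed ht hm).1 h
    refine ⟨l', h', (List.forall₂_cons.1 hL).2, fun x hx hxl => ?_⟩
    have hxi : x ≠ Fin.ofNat (N + 1) (t + 1) := by
      rintro rfl; rw [ofNat_val ht] at hx; omega
    rw [← h'.cycleLength_fixed ht hxi hxl]
    refine hd x (by omega) ?_
    rw [List.mem_cons]
    tauto
  · rintro ⟨l', h', hL, hd⟩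
    refine ⟨_, (isStage_succ_iff_of_fixed ht hm).2 ⟨l', rfl, h'⟩,
      List.forall₂_cons.2 ⟨fun _ => hm, hL⟩, fun x hx hxl => ?_⟩
    rw [List.mem_cons, not_or] at hxl
    rw [h'.cycleLength_fixed ht hxl.1 hxl.2]
    refine hd x ?_ hxl.2
    have : x.val ≠ t + 1 := fun q => hxl.1 (Fin.ext (by rw [ofNat_val ht, q]))
    omega

theorem fixed_of_mem_quadMatchings {t : ℕ} (ht : t + 1 ≤ N) {m : Equiv.Perm (Fin (N + 1))}
    {L : List Bool} (hm : m ∈ quadMatchings N t L) :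
    m (Fin.ofNat (N + 1) (t + 1)) = Fin.ofNat (N + 1) (t + 1) := by
  obtain ⟨l, h, -⟩ := hm
  exact h.fix _ (by rw [ofNat_val ht]; omega)

theorem quadMatchings_succ_true {t : ℕ} (ht : t + 1 ≤ N) (L : List Bool) :
    quadMatchings N (t + 1) (true :: L) = quadMatchings N t L := by
  ext m
  constructor
  · intro hm
    refine (mem_quadMatchings_succ_of_fixed ht ?_ true L).1 hm
    obtain ⟨l, h, hL, -⟩ := hm
    exact (List.forall₂_cons.1 hL).1 rfl
  · intro hm
    exact (mem_quadMatchings_succ_of_fixed ht (fixed_of_mem_quadMatchings ht hm) true L).2 hm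

theorem exists_split_of_mem_quadMatchings {t : ℕ} (ht : t + 1 ≤ N)
    {m : Equiv.Perm (Fin (N + 1))} {i : Fin (N + 1)} (hi : i = Fin.ofNat (N + 1) (t + 1))
    {L : List Bool} (hm : m ∈ quadMatchings N (t + 1) (false :: L)) (hmi : m i ≠ i) :
    m * Equiv.swap i (m i) ∈ quadMatchings N t (false :: false :: false :: true :: L) ∧
    ∃ l l₁ l₂, IsStage N t (m * Equiv.swap i (m i)) l ∧
      Fin.ofNat (N + 1) t :: l = l₁ ++ m i :: l₂ ∧ l₁.length = 3 := by
  obtain ⟨l₂, h, hL, hd⟩ := hm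
  obtain ⟨l₁, l, hl, hst, horb, happ⟩ := h.remove_chord ht hi rfl hmi
  have hmem : ∀ x, x ∈ Fin.ofNat (N + 1) t :: l ↔ x ∈ l₁ ∨ x = m i ∨ x ∈ l₂ := fun x => by
    rw [hl]; simp
  have hnot : ∀ x : Fin (N + 1), x.val ≤ t → x ≠ i := by
    rintro x hx rfl
    rw [hi, ofNat_val ht] at hx
    omega
  have hnd : (l₁ ++ m i :: l₂).Nodup := hl ▸ hst.orbit.1
  have hji : m i ∉ l₂ := fun q =>
    (List.nodup_cons.1 (List.nodup_append.1 hnd).2.1).1 q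
  have hlen : l₁.length = 3 := by
    have h4 := hd (m i) ?_ ?_
    · rw [horb.cycleLength_eq (by simp)] at h4
      omega
    · have := hst.le_of_mem (by omega) ((hmem (m i)).2 (by simp))
      omega
    · rw [← hi, List.mem_cons, not_or]
      exact ⟨hmi, hji⟩
  refine ⟨⟨l, hst, ?_, fun x hx hxl => ?_⟩, l, l₁, l₂, hst, hl, hlen⟩
  · rw [hl]
    obtain ⟨a, b, c, rfl⟩ := List.length_eq_three.1 hlen
    simp only [List.cons_append, List.nil_append, List.forall₂_cons, Bool.false_eq_true,
      false_implies, true_and, forall_const]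
    refine ⟨by rw [happ]; simp, (List.forall₂_cons.1 hL).2.imp fun b x hb hbt => ?_⟩
    rw [happ, hb hbt, ite_self]
  · have hxi := hnot x hx
    have := hst.cycleLength_add_chord ht hi (j := m i) ((hmem _).2 (by simp)) hxi hxl
    rw [← this]
    have hb : m * Equiv.swap i (m i) * Equiv.swap i (m i) = m := by simp [mul_assoc]
    rw [hb]
    refine hd x (by omega) ?_
    rw [← hi, List.mem_cons, not_or]
    rw [hmem] at hxl
    tauto

theorem exists_mem_quadMatchings_of_split {t : ℕ} (ht : t + 1 ≤ N)
    {m : Equiv.Perm (Fin (N + 1))} {i : Fin (N + 1)} (hi : i = Fin.ofNat (N + 1) (t + 1))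
    {L : List Bool} (hm : m ∈ quadMatchings N t (false :: false :: false :: true :: L)) :
    ∃ m' ∈ quadMatchings N (t + 1) (false :: L), m' i ≠ i ∧ m' * Equiv.swap i (m' i) = m := by
  obtain ⟨l, h, hL, hd⟩ := hm
  obtain ⟨l₁, j, l₂, hl, hlen⟩ : ∃ l₁ j l₂, Fin.ofNat (N + 1) t :: l = l₁ ++ j :: l₂ ∧
      l₁.length = 3 := by
    have := hL.length_eq
    match hl : Fin.ofNat (N + 1) t :: l, this with
    | a :: b :: c :: j :: l₂, _ => exact ⟨[a, b, c], j, l₂, rfl, rfl⟩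
  have hfl : m j = j ∧ List.Forall₂ (fun b x => b = true → m x = x) L l₂ := by
    rw [hl] at hL
    obtain ⟨a, b, c, rfl⟩ := List.length_eq_three.1 hlen
    simpa using hL
  have hmem : ∀ x, x ∈ Fin.ofNat (N + 1) t :: l ↔ x ∈ l₁ ∨ x = j ∨ x ∈ l₂ := fun x => by
    rw [hl]; simp
  obtain ⟨hji, hmi, hst, horb⟩ := h.add_chord ht hl hfl.1
  rw [← hi] at hji hmi hst horb
  have hjl : ∀ x ∈ l₂, x ≠ j := by
    have hnd : (l₁ ++ j :: l₂).Nodup := hl ▸ h.orbit.1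
    rintro x hx rfl
    exact (List.nodup_cons.1 (List.nodup_append.1 hnd).2.1).1 hx
  have hil : ∀ x ∈ l₂, x ≠ i := by
    rintro x hx rfl
    have := h.le_of_mem (by omega) ((hmem x).2 (Or.inr (Or.inr hx)))
    rw [hi, ofNat_val ht] at this
    omega
  refine ⟨m * Equiv.swap i j, ⟨l₂, hst, ?_, fun x hx hxl => ?_⟩, by rw [hmi]; exact hji, ?_⟩
  · refine List.forall₂_cons.2 ⟨by simp, ?_⟩
    refine (List.forall₂_iff_zip.2 ⟨hfl.2.length_eq, fun {b x} hbx hb => ?_⟩)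
    have hx := (List.of_mem_zip hbx).2
    rw [Equiv.Perm.mul_apply, Equiv.swap_apply_of_ne_of_ne (hil x hx) (hjl x hx)]
    exact (List.forall₂_iff_zip.1 hfl.2).2 hbx hb
  · rw [← hi, List.mem_cons, not_or] at hxl
    by_cases hx1 : x ∈ j :: l₁
    · rw [horb.cycleLength_eq hx1, hlen]
    · rw [List.mem_cons, not_or] at hx1
      have hxl' : x ∉ Fin.ofNat (N + 1) t :: l := by rw [hmem]; tauto
      rw [h.cycleLength_add_chord ht hi ((hmem j).2 (by simp)) hxl.1 hxl']
      refine hd x ?_ hxl'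
      have : x.val ≠ t + 1 := fun q => hxl.1 (Fin.ext (by rw [hi, ofNat_val ht, q]))
      omega
  · rw [hmi]; simp [mul_assoc]

theorem ncard_quadMatchings_succ_false {t : ℕ} (ht : t + 1 ≤ N) (L : List Bool) :
    (quadMatchings N (t + 1) (false :: L)).ncard = (quadMatchings N t L).ncard +
      (quadMatchings N t (false :: false :: false :: true :: L)).ncard := by
  obtain ⟨i, hi⟩ : ∃ i, i = Fin.ofNat (N + 1) (t + 1) := ⟨_, rfl⟩
  set A := {m ∈ quadMatchings N (t + 1) (false :: L) | m i ≠ i} with hA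
  have hunion : quadMatchings N (t + 1) (false :: L) = quadMatchings N t L ∪ A := by
    ext m
    by_cases hm : m i = i
    · have := mem_quadMatchings_succ_of_fixed ht (hi ▸ hm) false L
      simp [hA, hm, this]
    · have h1 : m ∉ quadMatchings N t L := fun q =>
        hm (hi ▸ fixed_of_mem_quadMatchings ht q)
      simp [hA, hm, h1]
  have hdisj : Disjoint (quadMatchings N t L) A := by
    rw [Set.disjoint_left]
    rintro m hm ⟨-, h2⟩
    exact h2 (hi ▸ fixed_of_mem_quadMatchings ht hm)
  rw [hunion, Set.ncard_union_eq hdisj, Nat.add_left_cancel_iff]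
  refine Set.ncard_congr (fun m _ => m * Equiv.swap i (m i))
    (fun m hm => (exists_split_of_mem_quadMatchings ht hi hm.1 hm.2).1) ?_ ?_
  · rintro m m' ⟨hm, hmi⟩ ⟨hm', hmi'⟩ heq
    obtain ⟨-, l, l₁, l₂, h, hl, hlen⟩ := exists_split_of_mem_quadMatchings ht hi hm hmi
    obtain ⟨-, l', l₁', l₂', h', hl', hlen'⟩ := exists_split_of_mem_quadMatchings ht hi hm' hmi'
    rw [← heq] at h'
    obtain rfl := h.orbit.unique h'.orbit
    have hj := eq_of_append_cons_eq_of_length (hl.symm.trans hl') (by omega)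
    rw [hj] at heq
    exact mul_right_cancel heq
  · intro m hm
    obtain ⟨m', h1, h2, h3⟩ := exists_mem_quadMatchings_of_split ht hi hm
    exact ⟨m', ⟨h1, h2⟩, h3⟩

end Recursion

section OpenMatchings

variable {N : ℕ}

/-- Noncrossing involutions `m` of `S ∩ {0, …, t}` with exactly `h` fixed points in
`S ∩ {0, …, t}`, all of which lie on the cycle of `downCycle N t * m` through `t`. -/
def openMatchings (N : ℕ) (S : Finset (Fin (N + 1))) (t h : ℕ) :
    Set (Equiv.Perm (Fin (N + 1))) :=
  {m | (∀ x ∉ S, m x = x) ∧ ∃ l, IsStage N t m l ∧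
    (∀ x ∈ S, x.val ≤ t → m x = x → x ∈ Fin.ofNat (N + 1) t :: l) ∧
    (S.filter fun x => x.val ≤ t ∧ m x = x).card = h}

theorem fixed_of_mem_openMatchings {t h : ℕ} (ht : t + 1 ≤ N) {S : Finset (Fin (N + 1))}
    {m : Equiv.Perm (Fin (N + 1))} (hm : m ∈ openMatchings N S t h) :
    m (Fin.ofNat (N + 1) (t + 1)) = Fin.ofNat (N + 1) (t + 1) := by
  obtain ⟨-, l, h, -⟩ := hm
  exact h.fix _ (by rw [ofNat_val ht]; omega)

theorem ncard_openMatchings_zero (S : Finset (Fin (N + 1))) (h : ℕ) :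
    (openMatchings N S 0 h).ncard = if (S.filter fun x => x.val ≤ 0).card = h then 1 else 0 := by
  have hval : ∀ x : Fin (N + 1), x.val ≤ 0 → x ∈ [Fin.ofNat (N + 1) 0] := fun x hx => by
    simp only [List.mem_singleton]
    exact Fin.ext (by simpa using hx)
  split_ifs with hh
  · rw [Set.ncard_eq_one]
    refine ⟨1, Set.ext fun m => ⟨?_, ?_⟩⟩
    · rintro ⟨-, l, h, -⟩
      exact (isStage_zero_iff.1 h).1
    · rintro rfl
      exact ⟨fun x _ => rfl, [], isStage_zero_iff.2 ⟨rfl, rfl⟩, fun x _ hx _ => hval x hx,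
        by simpa using hh⟩
  · rw [Set.ncard_eq_zero, Set.eq_empty_iff_forall_notMem]
    rintro m ⟨-, l, h, -, h2⟩
    rw [(isStage_zero_iff.1 h).1] at h2
    exact hh (by simpa using h2)

theorem le_succ_iff_le_or_eq_ofNat {t : ℕ} (ht : t + 1 ≤ N) (x : Fin (N + 1)) :
    x.val ≤ t + 1 ↔ x.val ≤ t ∨ x = Fin.ofNat (N + 1) (t + 1) := by
  rw [Fin.ext_iff, ofNat_val ht]
  omega

theorem card_filter_le_succ {t : ℕ} (ht : t + 1 ≤ N) (S : Finset (Fin (N + 1)))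
    (p : Fin (N + 1) → Prop) [DecidablePred p] :
    (S.filter fun x => x.val ≤ t + 1 ∧ p x).card = (S.filter fun x => x.val ≤ t ∧ p x).card +
      if Fin.ofNat (N + 1) (t + 1) ∈ S ∧ p (Fin.ofNat (N + 1) (t + 1)) then 1 else 0 := by
  have hnot : ¬ (Fin.ofNat (N + 1) (t + 1)).val ≤ t := by rw [ofNat_val ht]; omega
  split_ifs with h
  · rw [← Finset.card_insert_of_notMem (a := Fin.ofNat (N + 1) (t + 1))]
    · congr 1
      ext x
      simp only [Finset.mem_filter, Finset.mem_insert, le_succ_iff_le_or_eq_ofNat ht]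
      constructor
      · tauto
      · rintro (rfl | q)
        · exact ⟨h.1, Or.inr rfl, h.2⟩
        · tauto
    · rw [Finset.mem_filter]; tauto
  · rw [add_zero]
    congr 1
    ext x
    simp only [Finset.mem_filter, le_succ_iff_le_or_eq_ofNat ht]
    constructor
    · rintro ⟨h1, h2 | rfl, h3⟩
      · exact ⟨h1, h2, h3⟩
      · exact absurd ⟨h1, h3⟩ h
    · tauto

theorem mem_openMatchings_succ_of_fixed {t h : ℕ} (ht : t + 1 ≤ N) {S : Finset (Fin (N + 1))}
    {m : Equiv.Perm (Fin (N + 1))}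
    (hm : m (Fin.ofNat (N + 1) (t + 1)) = Fin.ofNat (N + 1) (t + 1)) :
    m ∈ openMatchings N S (t + 1)
        (h + if Fin.ofNat (N + 1) (t + 1) ∈ S then 1 else 0) ↔ m ∈ openMatchings N S t h := by
  have hcard := card_filter_le_succ ht S (fun x => m x = x)
  simp only [hm, and_true] at hcard
  constructor
  · rintro ⟨hS, l, h, hl, hc⟩
    obtain ⟨l', rfl, h'⟩ := (isStage_succ_iff_of_fixed ht hm).1 h
    refine ⟨hS, l', h', fun x hx hxt hmx => ?_, by omega⟩
    have hxi : x ≠ Fin.ofNat (N + 1) (t + 1) := by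
      rintro rfl; rw [ofNat_val ht] at hxt; omega
    exact (List.mem_cons.1 (hl x hx (by omega) hmx)).resolve_left hxi
  · rintro ⟨hS, l', h', hl, hc⟩
    refine ⟨hS, _, (isStage_succ_iff_of_fixed ht hm).2 ⟨l', rfl, h'⟩, fun x hx hxt hmx => ?_,
      by omega⟩
    rcases (le_succ_iff_le_or_eq_ofNat ht x).1 hxt with q | q
    · exact List.mem_cons_of_mem _ (hl x hx q hmx)
    · rw [q]; exact List.mem_cons_self

theorem exists_split_of_mem_openMatchings {t h : ℕ} (ht : t + 1 ≤ N) {S : Finset (Fin (N + 1))}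
    {m : Equiv.Perm (Fin (N + 1))} {i : Fin (N + 1)} (hi : i = Fin.ofNat (N + 1) (t + 1))
    (hm : m ∈ openMatchings N S (t + 1) h) (hmi : m i ≠ i) :
    m * Equiv.swap i (m i) ∈ openMatchings N S t (h + 1) ∧
    (m i ∈ S ∧ (m * Equiv.swap i (m i)) (m i) = m i) ∧
    ∃ l l₁ l₂, IsStage N t (m * Equiv.swap i (m i)) l ∧
      Fin.ofNat (N + 1) t :: l = l₁ ++ m i :: l₂ ∧
      ∀ x ∈ l₁, ¬ (x ∈ S ∧ (m * Equiv.swap i (m i)) x = x) := by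
  obtain ⟨hS, l₂, h, hd, hc⟩ := hm
  obtain ⟨l₁, l, hl, hst, horb, happ⟩ := h.remove_chord ht hi rfl hmi
  have hmem : ∀ x, x ∈ Fin.ofNat (N + 1) t :: l ↔ x ∈ l₁ ∨ x = m i ∨ x ∈ l₂ := fun x => by
    rw [hl]; simp
  have hle : ∀ x ∈ Fin.ofNat (N + 1) t :: l, x.val ≤ t := fun x hx => hst.le_of_mem (by omega) hx
  have hnot : ∀ x : Fin (N + 1), x.val ≤ t → x ≠ i := by
    rintro x hx rfl
    rw [hi, ofNat_val ht] at hx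
    omega
  have hnd : (l₁ ++ m i :: l₂).Nodup := hl ▸ hst.orbit.1
  rw [List.nodup_append] at hnd
  have hmm := involution_apply_apply h.sq i
  have hiS : i ∈ S := by
    by_contra q
    exact hmi (hS i q)
  have hjS : m i ∈ S := by
    by_contra q
    exact hmi (hmm.symm.trans (hS _ q)).symm
  have hjt : (m i).val ≤ t := hle _ ((hmem _).2 (by simp))
  refine ⟨⟨fun x hx => ?_, l, hst, fun x hx hxt hmx => ?_, ?_⟩, ⟨hjS, by rw [happ]; simp⟩,
    l, l₁, l₂, hst, hl, ?_⟩
  · rw [happ, hS x hx, ite_self]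
  · have hxi := hnot x hxt
    by_cases hxj : x = m i
    · rw [hmem]; tauto
    · rw [happ, if_neg (by tauto)] at hmx
      have := hd x hx (by omega) hmx
      rw [← hi, List.mem_cons] at this
      rw [hmem]; tauto
  · rw [← hc, card_filter_le_succ ht, if_neg (by rw [← hi]; tauto), add_zero,
      ← Finset.card_insert_of_notMem (a := m i)]
    · congr 1
      ext x
      simp only [Finset.mem_filter, Finset.mem_insert, happ]
      by_cases hxj : x = m i
      · subst hxj; simp [hjS, hjt]
      · constructor
        · rintro ⟨h1, h2, h3⟩
          rw [if_neg (by have := hnot x h2; tauto)] at h3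
          tauto
        · rintro (h1 | ⟨h1, h2, h3⟩)
          · exact absurd h1 hxj
          · exact ⟨h1, h2, by rw [h3, ite_self]⟩
    · rw [Finset.mem_filter]
      rintro ⟨-, -, q⟩
      rw [hmm] at q
      exact hmi q.symm
  · rintro x hx ⟨hxS, hmx⟩
    have hxt := hle x ((hmem x).2 (Or.inl hx))
    have hxi := hnot x hxt
    have hxj : x ≠ m i := fun q => hnd.2.2 x hx (m i) (by simp) q
    rw [happ, if_neg (by tauto)] at hmx
    have := hd x hxS (by omega) hmx
    rw [← hi, List.mem_cons] at this
    exact hnd.2.2 x hx x (by simp only [List.mem_cons]; tauto) rfl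

theorem exists_first_split {γ : Type*} {p : γ → Prop} {l : List γ} (h : ∃ x ∈ l, p x) :
    ∃ l₁ j l₂, l = l₁ ++ j :: l₂ ∧ p j ∧ ∀ x ∈ l₁, ¬ p x := by
  induction l with
  | nil => simp at h
  | cons a l ih =>
    by_cases ha : p a
    · exact ⟨[], a, l, rfl, ha, by simp⟩
    · obtain ⟨l₁, j, l₂, rfl, hj, hl⟩ := ih (by simpa [ha] using h)
      exact ⟨a :: l₁, j, l₂, rfl, hj, by simpa [ha] using hl⟩

theorem exists_mem_openMatchings_of_split {t h : ℕ} (ht : t + 1 ≤ N) {S : Finset (Fin (N + 1))}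
    {m : Equiv.Perm (Fin (N + 1))} {i : Fin (N + 1)} (hi : i = Fin.ofNat (N + 1) (t + 1))
    (hiS : i ∈ S) (hm : m ∈ openMatchings N S t (h + 1)) :
    ∃ m' ∈ openMatchings N S (t + 1) h, m' i ≠ i ∧ m' * Equiv.swap i (m' i) = m := by
  obtain ⟨hS, l, h, hd, hc⟩ := hm
  have hex : ∃ x ∈ Fin.ofNat (N + 1) t :: l, x ∈ S ∧ m x = x := by
    obtain ⟨x, hx⟩ := Finset.card_pos.1 (by omega : 0 < (S.filter fun x => x.val ≤ t ∧ m x = x).card)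
    obtain ⟨h1, h2, h3⟩ := Finset.mem_filter.1 hx
    exact ⟨x, hd x h1 h2 h3, h1, h3⟩
  obtain ⟨l₁, j, l₂, hl, ⟨hjS, hj⟩, hfirst⟩ := exists_first_split hex
  have hmem : ∀ x, x ∈ Fin.ofNat (N + 1) t :: l ↔ x ∈ l₁ ∨ x = j ∨ x ∈ l₂ := fun x => by
    rw [hl]; simp
  obtain ⟨hji, hmi, hst, horb⟩ := h.add_chord ht hl hj
  rw [← hi] at hji hmi hst horb
  have hjt := h.le_of_mem (by omega) ((hmem j).2 (by simp))
  have happ : ∀ x, x ≠ i → x ≠ j → (m * Equiv.swap i j) x = m x := fun x h1 h2 => by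
    rw [Equiv.Perm.mul_apply, Equiv.swap_apply_of_ne_of_ne h1 h2]
  have hmj : (m * Equiv.swap i j) j ≠ j := by
    have : m i = i := h.fix _ (by rw [hi, ofNat_val ht]; omega)
    rw [Equiv.Perm.mul_apply, Equiv.swap_apply_right, this]
    exact hji.symm
  refine ⟨m * Equiv.swap i j, ⟨fun x hx => ?_, l₂, hst, fun x hx hxt hmx => ?_, ?_⟩,
    by rw [hmi]; exact hji, by rw [hmi]; simp [mul_assoc]⟩
  · rw [happ x (by rintro rfl; exact hx hiS) (by rintro rfl; exact hx hjS), hS x hx]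
  · rw [← hi, List.mem_cons]
    by_cases hxi : x = i
    · exact Or.inl hxi
    · have hxj : x ≠ j := by rintro rfl; exact hmj hmx
      rw [happ x hxi hxj] at hmx
      have hxt' : x.val ≤ t :=
        ((le_succ_iff_le_or_eq_ofNat ht x).1 hxt).resolve_right (hi ▸ hxi)
      rcases (hmem x).1 (hd x hx hxt' hmx) with q | q | q
      · exact absurd ⟨hx, hmx⟩ (hfirst x q)
      · exact absurd q hxj
      · exact Or.inr q
  · rw [card_filter_le_succ ht, if_neg (by rw [← hi, hmi]; tauto), add_zero]
    have : insert j (S.filter fun x => x.val ≤ t ∧ (m * Equiv.swap i j) x = x)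
        = S.filter fun x => x.val ≤ t ∧ m x = x := by
      ext x
      simp only [Finset.mem_insert, Finset.mem_filter]
      by_cases hxj : x = j
      · subst hxj; simp [hjS, hjt, hj]
      · simp only [hxj, false_or]
        refine and_congr_right fun _ => and_congr_right fun hxt => ?_
        rw [happ x _ hxj]
        rintro rfl
        rw [hi, ofNat_val ht] at hxt
        omega
    rw [← this, Finset.card_insert_of_notMem] at hc
    · omega
    · rw [Finset.mem_filter]; tauto

theorem openMatchings_succ_of_notMem {t h : ℕ} (ht : t + 1 ≤ N) {S : Finset (Fin (N + 1))}
    (hiS : Fin.ofNat (N + 1) (t + 1) ∉ S) :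
    openMatchings N S (t + 1) h = openMatchings N S t h := by
  ext m
  by_cases hm : m (Fin.ofNat (N + 1) (t + 1)) = Fin.ofNat (N + 1) (t + 1)
  · have := mem_openMatchings_succ_of_fixed (h := h) (S := S) ht hm
    rwa [if_neg hiS] at this
  · constructor
    · rintro ⟨hS, -⟩
      exact absurd (hS _ hiS) hm
    · intro q
      exact absurd (fixed_of_mem_openMatchings ht q) hm

theorem ncard_openMatchings_chord {t h : ℕ} (ht : t + 1 ≤ N) {S : Finset (Fin (N + 1))}
    {i : Fin (N + 1)} (hi : i = Fin.ofNat (N + 1) (t + 1)) (hiS : i ∈ S) :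
    {m ∈ openMatchings N S (t + 1) h | m i ≠ i}.ncard = (openMatchings N S t (h + 1)).ncard := by
  refine Set.ncard_congr (fun m _ => m * Equiv.swap i (m i))
    (fun m hm => (exists_split_of_mem_openMatchings ht hi hm.1 hm.2).1) ?_ ?_
  · rintro m m' ⟨hm, hmi⟩ ⟨hm', hmi'⟩ heq
    obtain ⟨-, hp, l, l₁, l₂, h, hl, hf⟩ := exists_split_of_mem_openMatchings ht hi hm hmi
    obtain ⟨-, hp', l', l₁', l₂', h', hl', hf'⟩ :=
      exists_split_of_mem_openMatchings ht hi hm' hmi'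
    rw [← heq] at h' hf' hp'
    obtain rfl := h.orbit.unique h'.orbit
    have hj := eq_of_append_cons_eq_of_first (hl.symm.trans hl') hf hf' hp hp'
    rw [hj] at heq
    exact mul_right_cancel heq
  · intro m hm
    obtain ⟨m', h1, h2, h3⟩ := exists_mem_openMatchings_of_split ht hi hiS hm
    exact ⟨m', ⟨h1, h2⟩, h3⟩

theorem ncard_openMatchings_succ_zero {t : ℕ} (ht : t + 1 ≤ N) {S : Finset (Fin (N + 1))}
    (hiS : Fin.ofNat (N + 1) (t + 1) ∈ S) :
    (openMatchings N S (t + 1) 0).ncard = (openMatchings N S t 1).ncard := by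
  rw [← ncard_openMatchings_chord ht rfl hiS]
  congr 1
  ext m
  refine ⟨fun hm => ⟨hm, fun q => ?_⟩, fun hm => hm.1⟩
  obtain ⟨-, l, -, -, hc⟩ := hm
  rw [card_filter_le_succ ht, if_pos ⟨hiS, q⟩] at hc
  omega

theorem ncard_openMatchings_succ_succ {t h : ℕ} (ht : t + 1 ≤ N) {S : Finset (Fin (N + 1))}
    (hiS : Fin.ofNat (N + 1) (t + 1) ∈ S) :
    (openMatchings N S (t + 1) (h + 1)).ncard =
      (openMatchings N S t h).ncard + (openMatchings N S t (h + 2)).ncard := by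
  rw [← ncard_openMatchings_chord ht rfl hiS, ← Set.ncard_union_eq]
  · congr 1
    ext m
    by_cases hm : m (Fin.ofNat (N + 1) (t + 1)) = Fin.ofNat (N + 1) (t + 1)
    · have := mem_openMatchings_succ_of_fixed (h := h) (S := S) ht hm
      rw [if_pos hiS] at this
      rw [Set.mem_union, Set.mem_sep_iff, this]
      tauto
    · have h1 : m ∉ openMatchings N S t h := fun q => hm (fixed_of_mem_openMatchings ht q)
      rw [Set.mem_union, Set.mem_sep_iff]
      tauto
  · rw [Set.disjoint_left]
    rintro m hm ⟨-, h2⟩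
    exact h2 (fixed_of_mem_openMatchings ht hm)

end OpenMatchings

section Counting

variable {N : ℕ}

theorem ncard_quadMatchings_of_lt {t : ℕ} (ht : t ≤ N) {L : List Bool} (hL : t + 1 < L.length) :
    (quadMatchings N t L).ncard = 0 := by
  induction t generalizing L with
  | zero => rw [ncard_quadMatchings_zero, if_neg (by omega)]
  | succ t ih =>
    match L with
    | [] => rw [quadMatchings_nil, Set.ncard_empty]
    | true :: L =>
      rw [List.length_cons] at hL
      rw [quadMatchings_succ_true ht, ih (by omega) (by omega)]
    | false :: L =>
      rw [List.length_cons] at hL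
      rw [ncard_quadMatchings_succ_false ht, ih (by omega) (by omega), ih (by omega)]
      simp only [List.length_cons]
      omega

theorem ncard_quadMatchings_eq {t : ℕ} (ht : t ≤ N) {L : List Bool} {q c : ℕ}
    (hL : L.length + 4 * q = t + 1) (hc : L.count false = c) :
    (c = 0 → (quadMatchings N t L).ncard = if q = 0 then 1 else 0) ∧
    (c ≠ 0 → q.factorial * (2 * q + c).factorial * (quadMatchings N t L).ncard
      = c * (3 * q + c - 1).factorial) := by
  induction t generalizing L q c with
  | zero =>
    have hq : q = 0 := by
      by_contra
      omega
    subst hq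
    have h1 : c ≤ 1 := by
      have := L.count_le_length (a := false)
      omega
    rw [ncard_quadMatchings_zero, if_pos (by omega)]
    interval_cases c <;> simp
  | succ t ih =>
    match L with
    | [] =>
      rw [List.count_nil] at hc
      rw [quadMatchings_nil, Set.ncard_empty, if_neg (by rintro rfl; simp at hL)]
      exact ⟨fun _ => rfl, fun h => absurd hc.symm h⟩
    | true :: L =>
      rw [List.length_cons] at hL
      rw [quadMatchings_succ_true ht]
      exact ih (by omega) (by omega) (by simpa using hc)
    | false :: L =>
      rw [List.length_cons] at hL
      obtain ⟨c', hc'⟩ : ∃ c', L.count false = c' := ⟨_, rfl⟩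
      have hcc : c = c' + 1 := by simpa [hc'] using hc.symm
      subst hcc
      obtain ⟨h10, h11⟩ := ih (by omega) (by omega : L.length + 4 * q = t + 1) hc'
      refine ⟨fun h => by omega, fun _ => ?_⟩
      rw [ncard_quadMatchings_succ_false ht]
      cases q with
      | zero =>
        rw [ncard_quadMatchings_of_lt (by omega)
          (L := false :: false :: false :: true :: L) (by simp only [List.length_cons]; omega)]
        cases c' with
        | zero => rw [h10 rfl]; simp
        | succ d =>
          have h := h11 (by omega)
          simp only [Nat.factorial_zero, mul_zero, zero_add, one_mul, add_zero,
            Nat.add_sub_cancel, Nat.factorial_succ] at h ⊢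
          rw [mul_assoc, h]
      | succ q =>
        obtain ⟨-, h2⟩ := ih (L := false :: false :: false :: true :: L) (q := q) (c := c' + 3)
          (by omega) (by simp only [List.length_cons]; omega) (by simp [hc'])
        have h2 := h2 (by omega)
        cases c' with
        | zero =>
          rw [h10 rfl, if_neg (by omega), zero_add]
          rw [show 3 * q + (0 + 3) - 1 = 3 * q + 2 by omega] at h2
          rw [show 2 * (q + 1) + (0 + 1) = 2 * q + (0 + 3) by omega,
            show 3 * (q + 1) + (0 + 1) - 1 = 3 * q + 2 + 1 by omega, Nat.factorial_succ q,
            Nat.factorial_succ (3 * q + 2)]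
          linear_combination (q + 1) * h2
        | succ d =>
          have h1 := h11 (by omega)
          rw [show 2 * (q + 1) + (d + 1) = 2 * q + d + 3 by omega,
            show 3 * (q + 1) + (d + 1) - 1 = 3 * q + d + 3 by omega, Nat.factorial_succ q] at h1
          rw [show 3 * q + (d + 1 + 3) - 1 = 3 * q + d + 3 by omega,
            show 2 * q + (d + 1 + 3) = 2 * q + d + 3 + 1 by omega,
            Nat.factorial_succ (2 * q + d + 3)] at h2
          rw [show 2 * (q + 1) + (d + 1 + 1) = 2 * q + d + 3 + 1 by omega,
            show 3 * (q + 1) + (d + 1 + 1) - 1 = 3 * q + d + 3 + 1 by omega, Nat.factorial_succ q,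
            Nat.factorial_succ (2 * q + d + 3), Nat.factorial_succ (3 * q + d + 3)]
          linear_combination (2 * q + d + 4) * h1 + (q + 1) * h2

/-- The number of nonnegative lattice paths with `n` steps `±1` from `0` to height `h`. -/
def ballot : ℕ → ℕ → ℕ
  | 0, h => if h = 0 then 1 else 0
  | n + 1, 0 => ballot n 1
  | n + 1, h + 1 => ballot n h + ballot n (h + 2)

theorem ballot_of_lt {n h : ℕ} (hn : n < h) : ballot n h = 0 := by
  induction n generalizing h with
  | zero => simp [ballot]; omega
  | succ n ih =>
    cases h with
    | zero => omega
    | succ h => rw [ballot, ih (by omega), ih (by omega)]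

theorem ballot_mul_factorial {n h q : ℕ} (hn : n = h + 2 * q) :
    ballot n h * q.factorial * (h + q + 1).factorial = (h + 1) * n.factorial := by
  induction n generalizing h q with
  | zero =>
    obtain rfl : h = 0 := by omega
    obtain rfl : q = 0 := by omega
    rfl
  | succ n ih =>
    cases h with
    | zero =>
      obtain ⟨q, rfl⟩ : ∃ q', q = q' + 1 := ⟨q - 1, by omega⟩
      have h1 := ih (by omega : n = 1 + 2 * q)
      rw [ballot, Nat.factorial_succ q, Nat.factorial_succ n]
      rw [show 1 + q + 1 = 0 + (q + 1) + 1 by omega] at h1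
      have h3 : n + 1 = 2 * (q + 1) := by omega
      rw [h3]
      linear_combination (q + 1) * h1
    | succ h =>
      have h1 := ih (by omega : n = h + 2 * q)
      rw [ballot]
      cases q with
      | zero =>
        obtain rfl : n = h := by omega
        rw [ballot_of_lt (by omega : n < n + 2)]
        simp only [add_zero, Nat.factorial_succ] at h1 ⊢
        linear_combination (n + 2) * h1
      | succ q =>
        have h2 := ih (by omega : n = h + 2 + 2 * q)
        rw [show h + (q + 1) + 1 = h + q + 2 by omega, Nat.factorial_succ q] at h1
        rw [show h + 2 + q + 1 = h + q + 2 + 1 by omega, Nat.factorial_succ (h + q + 2)] at h2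
        rw [show h + 1 + (q + 1) + 1 = h + q + 2 + 1 by omega, Nat.factorial_succ q,
          Nat.factorial_succ (h + q + 2), Nat.factorial_succ n]
        have h3 : n = h + 2 * q + 2 := by omega
        have h4 : n.factorial * n = n.factorial * (h + 2 * q + 2) := by rw [← h3]
        linear_combination (h + q + 3) * h1 + (q + 1) * h2 - (h + 2) * h4

theorem ncard_openMatchings_eq (S : Finset (Fin (N + 1))) {t : ℕ} (ht : t ≤ N) (h : ℕ) :
    (openMatchings N S t h).ncard = ballot (S.filter fun x => x.val ≤ t).card h := by
  induction t generalizing h with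
  | zero =>
    rw [ncard_openMatchings_zero]
    have h1 : (S.filter fun x => x.val ≤ 0).card ≤ 1 := Finset.card_le_one.2 fun x hx y hy => by
      have := (Finset.mem_filter.1 hx).2
      have := (Finset.mem_filter.1 hy).2
      exact Fin.ext (by omega)
    interval_cases (S.filter fun x => x.val ≤ 0).card
    · simp [ballot, eq_comm]
    · rcases h with _ | _ | h <;> simp [ballot]
  | succ t ih =>
    have hcard := card_filter_le_succ ht S (fun _ => True)
    simp only [and_true] at hcard
    rw [hcard]
    by_cases hiS : Fin.ofNat (N + 1) (t + 1) ∈ S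
    · rw [if_pos hiS]
      cases h with
      | zero => rw [ncard_openMatchings_succ_zero ht hiS, ih (by omega), ballot]
      | succ h => rw [ncard_openMatchings_succ_succ ht hiS, ih (by omega), ih (by omega), ballot]
    · rw [if_neg hiS, openMatchings_succ_of_notMem ht hiS, ih (by omega), add_zero]

end Counting

section TreePairs

theorem mul_cycleCount_eq_card {β : Type*} [Finite β] {π : Equiv.Perm β} {k : ℕ}
    (h : ∀ x, cycleLength π x = k) : k * cycleCount π = Nat.card β := by
  classical
  have := Fintype.ofFinite (Quot π.SameCycle)
  rw [Nat.card_congr (Equiv.sigmaFiberEquiv (Quot.mk π.SameCycle)).symm, Nat.card_sigma,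
    Finset.sum_const_nat (m := k), cycleCount, Nat.card_eq_fintype_card, mul_comm,
    Finset.card_univ]
  rintro q -
  obtain ⟨x, rfl⟩ := Quot.exists_rep q
  rw [← h x]
  exact Nat.card_congr (Equiv.subtypeEquivRight fun y => by
    rw [quot_mk_sameCycle_eq_iff, Equiv.Perm.sameCycle_comm])

theorem cycleCount_eq_one {β : Type*} [Nonempty β] {π : Equiv.Perm β}
    (h : ∀ x y, π.SameCycle x y) : cycleCount π = 1 := by
  rw [cycleCount, Nat.card_eq_one_iff_unique]
  exact ⟨⟨fun a b => by
    obtain ⟨x, rfl⟩ := Quot.exists_rep a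
    obtain ⟨y, rfl⟩ := Quot.exists_rep b
    exact Quot.sound (h x y)⟩, ⟨Quot.mk _ (Classical.arbitrary β)⟩⟩

theorem exists_orbitList_downCycle {N t : ℕ} (ht : t ≤ N) :
    ∃ l, OrbitList (downCycle N t) (Fin.ofNat (N + 1) t) l ∧
      ∀ x : Fin (N + 1), x.val ≤ t → x ∈ Fin.ofNat (N + 1) t :: l := by
  induction t with
  | zero =>
    refine ⟨[], by simp [OrbitList, downCycle], fun x hx => ?_⟩
    rw [List.mem_singleton]
    exact Fin.ext (by simpa using hx)
  | succ t ih =>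
    obtain ⟨l, h, hl⟩ := ih (by omega)
    refine ⟨_, h.swap_mul (downCycle_apply_of_lt (by omega) ?_) (ofNat_succ_ne ht), fun x hx => ?_⟩
    · rw [ofNat_val ht]; omega
    · rcases (le_succ_iff_le_or_eq_ofNat ht x).1 hx with q | q
      · exact List.mem_cons_of_mem _ (hl x q)
      · rw [q]; exact List.mem_cons_self

theorem sameCycle_downCycle (N : ℕ) (x y : Fin (N + 1)) : (downCycle N N).SameCycle x y := by
  obtain ⟨l, h, hl⟩ := exists_orbitList_downCycle (le_refl N)
  exact (h.mem_iff.1 (hl x (by omega))).symm.trans (h.mem_iff.1 (hl y (by omega)))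

/-- A pair of involutions with complementary supports, both noncrossing with respect to `τ`, such
that all cycles of `τ * m₂` have length four. -/
structure TreePair {β : Type*} [Fintype β] [DecidableEq β] (τ m₁ m₂ : Equiv.Perm β) : Prop where
  sq₁ : m₁ * m₁ = 1
  sq₂ : m₂ * m₂ = 1
  compl : ∀ x, m₁ x ≠ x ↔ m₂ x = x
  noncrossing₁ : Noncrossing τ m₁
  noncrossing₂ : Noncrossing τ m₂
  face : ∀ x, cycleLength (τ * m₂) x = 4

theorem card_support_add_card_fixed {β : Type*} [Fintype β] [DecidableEq β] (m : Equiv.Perm β) :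
    (Finset.univ.filter fun x => m x = x).card + m.support.card = Fintype.card β := by
  rw [← Finset.card_univ, ← Finset.card_filter_add_card_filter_not (s := Finset.univ)
    (fun x => m x = x)]
  rfl

theorem card_support_add_of_compl {β : Type*} [Fintype β] [DecidableEq β] {m₁ m₂ : Equiv.Perm β}
    (h : ∀ x, m₁ x ≠ x ↔ m₂ x = x) : m₁.support.card + m₂.support.card = Fintype.card β := by
  rw [← card_support_add_card_fixed m₂]
  congr 2
  ext x
  simp [h x]

theorem mem_quadMatchings_top_iff {N : ℕ} {m : Equiv.Perm (Fin (N + 1))} :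
    m ∈ quadMatchings N N [false, false, false, false] ↔
      m * m = 1 ∧ Noncrossing (downCycle N N) m ∧ ∀ x, cycleLength (downCycle N N * m) x = 4 := by
  constructor
  · rintro ⟨l, h, hL, hc⟩
    refine ⟨h.sq, h.noncrossing, fun x => ?_⟩
    by_cases hx : x ∈ Fin.ofNat (N + 1) N :: l
    · rw [h.orbit.cycleLength_eq hx]
      simpa using hL.length_eq.symm
    · exact hc x (by omega) hx
  · rintro ⟨h1, h2, h3⟩
    obtain ⟨l, hl⟩ := exists_orbitList (downCycle N N * m) (Fin.ofNat (N + 1) N)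
    have hlen := h3 (Fin.ofNat (N + 1) N)
    rw [hl.cycleLength_eq List.mem_cons_self] at hlen
    refine ⟨l, ⟨h1, fun x hx => by omega, h2, hl⟩, ?_, fun x _ _ => h3 x⟩
    match l, hlen with
    | [a, b, c], _ => simp

theorem mem_openMatchings_top_iff {N : ℕ} {S : Finset (Fin (N + 1))}
    {m : Equiv.Perm (Fin (N + 1))} :
    m ∈ openMatchings N S N 0 ↔
      m * m = 1 ∧ Noncrossing (downCycle N N) m ∧ ∀ x, m x ≠ x ↔ x ∈ S := by
  constructor
  · rintro ⟨hS, l, h, -, hc⟩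
    refine ⟨h.sq, h.noncrossing, fun x => ⟨fun hx => ?_, fun hx q => ?_⟩⟩
    · by_contra q
      exact hx (hS x q)
    · rw [Finset.card_eq_zero, Finset.filter_eq_empty_iff] at hc
      exact hc hx ⟨by omega, q⟩
  · rintro ⟨h1, h2, h3⟩
    obtain ⟨l, hl⟩ := exists_orbitList (downCycle N N * m) (Fin.ofNat (N + 1) N)
    refine ⟨fun x hx => ?_, l, ⟨h1, fun x hx => by omega, h2, hl⟩,
      fun x hx _ q => absurd q ((h3 x).2 hx), ?_⟩
    · by_contra q
      exact hx ((h3 x).1 q)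
    · rw [Finset.card_eq_zero, Finset.filter_eq_empty_iff]
      exact fun x hx q => (h3 x).2 hx q.2

/-- Grouping tree pairs by their second component. -/
def treePairEquiv (N : ℕ) :
    {p : Equiv.Perm (Fin (N + 1)) × Equiv.Perm (Fin (N + 1)) //
      TreePair (downCycle N N) p.1 p.2} ≃
    Σ m : quadMatchings N N [false, false, false, false],
      openMatchings N (Finset.univ.filter fun x => m.1 x = x) N 0 where
  toFun p := ⟨⟨p.1.2, mem_quadMatchings_top_iff.2 ⟨p.2.sq₂, p.2.noncrossing₂, p.2.face⟩⟩,
    ⟨p.1.1, mem_openMatchings_top_iff.2 ⟨p.2.sq₁, p.2.noncrossing₁, fun x => by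
      simpa using p.2.compl x⟩⟩⟩
  invFun q := ⟨(q.2.1, q.1.1), by
    obtain ⟨⟨m, hm⟩, ⟨m', hm'⟩⟩ := q
    obtain ⟨h1, h2, h3⟩ := mem_quadMatchings_top_iff.1 hm
    obtain ⟨h1', h2', h3'⟩ := mem_openMatchings_top_iff.1 hm'
    exact ⟨h1', h1, fun x => by simpa using h3' x, h2', h2, h3⟩⟩
  left_inv _ := rfl
  right_inv _ := rfl

theorem card_treePair (g : ℕ) :
    Nat.card {p : Equiv.Perm (Fin (4 * g + 3 + 1)) × Equiv.Perm (Fin (4 * g + 3 + 1)) //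
      TreePair (downCycle (4 * g + 3) (4 * g + 3)) p.1 p.2} *
      (g.factorial * (g + 2).factorial * (g + 3).factorial) = 4 * (3 * g + 3).factorial := by
  classical
  set N := 4 * g + 3 with hN
  have := Fintype.ofFinite (quadMatchings N N [false, false, false, false])
  have hone : cycleCount (downCycle N N) = 1 := cycleCount_eq_one (sameCycle_downCycle N)
  have hfib : ∀ m : quadMatchings N N [false, false, false, false],
      Nat.card (openMatchings N (Finset.univ.filter fun x => m.1 x = x) N 0)
        = ballot (2 * (g + 2)) 0 := fun m => by
    obtain ⟨h1, h2, h3⟩ := mem_quadMatchings_top_iff.1 m.2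
    have h4 := mul_cycleCount_eq_card h3
    have h5 := card_support_add_card_fixed m.1
    rw [Noncrossing, hone] at h2
    rw [Nat.card_eq_fintype_card, Fintype.card_fin] at h4
    rw [Fintype.card_fin] at h5
    rw [Nat.card_coe_set_eq, ncard_openMatchings_eq _ le_rfl, Finset.filter_true_of_mem
      (fun x _ => by omega)]
    congr 1
    omega
  have hquad := (ncard_quadMatchings_eq (N := N) le_rfl (L := [false, false, false, false])
    (q := g) (c := 4) (by simp only [List.length_cons, List.length_nil]; omega) rfl).2 (by omega)
  have hbal := ballot_mul_factorial (n := 2 * (g + 2)) (h := 0) (q := g + 2) (by omega)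
  rw [Nat.card_congr (treePairEquiv N), Nat.card_sigma, Finset.sum_congr rfl fun m _ => hfib m,
    Finset.sum_const, Finset.card_univ, ← Nat.card_eq_fintype_card, Nat.card_coe_set_eq,
    smul_eq_mul]
  rw [show 3 * g + 4 - 1 = 3 * g + 3 by omega, show 2 * g + 4 = 2 * (g + 2) by omega] at hquad
  rw [show 0 + (g + 2) + 1 = g + 3 by omega, zero_add, one_mul] at hbal
  refine Nat.eq_of_mul_eq_mul_left (Nat.factorial_pos (2 * (g + 2))) ?_
  linear_combination ballot (2 * (g + 2)) 0 * (g + 2).factorial * (g + 3).factorial * hquad +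
    4 * (3 * g + 3).factorial * hbal

end TreePairs

section DecoratedMaps

theorem TreePair.mul_apply_of_ne {β : Type*} [Fintype β] [DecidableEq β] {τ m₁ m₂ : Equiv.Perm β}
    (h : TreePair τ m₁ m₂) {x : β} (hx : m₁ x ≠ x) : (m₁ * m₂) x = m₁ x := by
  rw [Equiv.Perm.mul_apply, (h.compl x).1 hx]

theorem TreePair.mul_apply_of_eq {β : Type*} [Fintype β] [DecidableEq β] {τ m₁ m₂ : Equiv.Perm β}
    (h : TreePair τ m₁ m₂) {x : β} (hx : m₁ x = x) : (m₁ * m₂) x = m₂ x := by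
  rw [Equiv.Perm.mul_apply]
  by_contra q
  have h1 := (h.compl _).1 q
  rw [involution_apply_apply h.sq₂] at h1
  exact (h.compl x).2 h1.symm hx

theorem TreePair.apply_ne {β : Type*} [Fintype β] [DecidableEq β] {τ m₁ m₂ : Equiv.Perm β}
    (h : TreePair τ m₁ m₂) {x : β} (hx : m₁ x ≠ x) : m₁ (m₁ x) ≠ m₁ x := by
  rw [involution_apply_apply h.sq₁]
  exact hx.symm

theorem TreePair.mul_mul_eq {β : Type*} [Fintype β] [DecidableEq β] {τ m₁ m₂ : Equiv.Perm β}
    (h : TreePair τ m₁ m₂) : τ * m₁ * (m₁ * m₂) = τ * m₂ := by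
  rw [mul_assoc, ← mul_assoc m₁, h.sq₁, one_mul]

theorem TreePair.support_nonempty {β : Type*} [Fintype β] [DecidableEq β] [Nonempty β]
    {τ m₁ m₂ : Equiv.Perm β} (h : TreePair τ m₁ m₂) : m₁.support.Nonempty := by
  rw [Finset.nonempty_iff_ne_empty]
  intro hs
  have h1 := card_support_add_of_compl h.compl
  rw [hs, Finset.card_empty] at h1
  have h2 := h.noncrossing₂
  have h3 := mul_cycleCount_eq_card h.face
  have := Fintype.card_pos (α := β)
  rw [Nat.card_eq_fintype_card] at h3
  rw [Noncrossing] at h2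
  omega

/-- The rooted map whose contour walk around the spanning tree given by `m₁` is `τ`. -/
def treeMap {n : ℕ} {τ m₁ m₂ : Equiv.Perm (Fin n)} (h : TreePair τ m₁ m₂)
    (hτ : ∀ x y, τ.SameCycle x y) (r : Fin n) : RootedMap where
  nd := n
  sigma := τ * m₁
  alpha := m₁ * m₂
  alpha_invol x := by
    by_cases hx : m₁ x = x
    · have h1 : m₂ x ≠ x := fun q => (h.compl x).2 q hx
      have h2 : m₁ (m₂ x) = m₂ x := h.mul_apply_of_eq hx
      rw [h.mul_apply_of_eq hx, h.mul_apply_of_eq h2, involution_apply_apply h.sq₂]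
    · rw [h.mul_apply_of_ne hx, h.mul_apply_of_ne (h.apply_ne hx), involution_apply_apply h.sq₁]
  alpha_fixfree x := by
    by_cases hx : m₁ x = x
    · rw [h.mul_apply_of_eq hx]
      exact fun q => (h.compl x).2 q hx
    · rwa [h.mul_apply_of_ne hx]
  root := r
  conn d d' := by
    have hstep : ∀ g ∈ ({τ * m₁, m₁ * m₂} : Set (Equiv.Perm (Fin n))), ∀ x,
        (∃ k ∈ Subgroup.closure {τ * m₁, m₁ * m₂}, k d = x) →
        ∃ k ∈ Subgroup.closure {τ * m₁, m₁ * m₂}, k d = g x := by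
      rintro g hg x ⟨k, hk, rfl⟩
      exact ⟨g * k, mul_mem (Subgroup.subset_closure hg) hk, rfl⟩
    refine mem_of_sameCycle (C := fun x => ∃ k ∈ Subgroup.closure {τ * m₁, m₁ * m₂}, k d = x)
      (fun x hx => ?_) (hτ d d') ⟨1, one_mem _, rfl⟩
    have h1 : ∃ k ∈ Subgroup.closure {τ * m₁, m₁ * m₂}, k d = m₁ x := by
      by_cases hm : m₁ x = x
      · rwa [hm]
      · rw [← h.mul_apply_of_ne hm]
        exact hstep _ (by simp) x hx
    have h2 := hstep (τ * m₁) (by simp) _ h1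
    rwa [Equiv.Perm.mul_apply, involution_apply_apply h.sq₁] at h2

theorem card_quot_subtype_sameCycle {n : ℕ} {σ : Equiv.Perm (Fin n)} {S : Finset (Fin n)}
    (h : ∀ d, ∃ d' ∈ S, σ.SameCycle d d') :
    Nat.card (Quot fun a b : {d : Fin n // d ∈ S} => σ.SameCycle a.1 b.1) = cycleCount σ := by
  refine Nat.card_eq_of_bijective (Quot.map Subtype.val fun a b h => h) ⟨fun a b hab => ?_,
    fun q => ?_⟩
  · obtain ⟨x, rfl⟩ := Quot.exists_rep a
    obtain ⟨y, rfl⟩ := Quot.exists_rep b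
    exact Quot.sound (quot_mk_sameCycle_eq_iff.1 hab)
  · obtain ⟨x, rfl⟩ := Quot.exists_rep q
    obtain ⟨y, hy, hxy⟩ := h x
    exact ⟨Quot.mk _ ⟨y, hy⟩, Quot.sound hxy.symm⟩

theorem phi_treeMap {n : ℕ} {τ m₁ m₂ : Equiv.Perm (Fin n)} (h : TreePair τ m₁ m₂)
    (hτ : ∀ x y, τ.SameCycle x y) (r : Fin n) : (treeMap h hτ r).phi = τ * m₂ :=
  h.mul_mul_eq

theorem four_mul_faces_treeMap {n : ℕ} {τ m₁ m₂ : Equiv.Perm (Fin n)} (h : TreePair τ m₁ m₂)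
    (hτ : ∀ x y, τ.SameCycle x y) (r : Fin n) : 4 * (treeMap h hτ r).faces = n := by
  rw [RootedMap.faces, phi_treeMap]
  exact (mul_cycleCount_eq_card h.face).trans (by simp)

theorem isQAngulation_treeMap {n : ℕ} {τ m₁ m₂ : Equiv.Perm (Fin n)} (h : TreePair τ m₁ m₂)
    (hτ : ∀ x y, τ.SameCycle x y) (r : Fin n) : (treeMap h hτ r).IsQAngulation 4 := fun d => by
  rw [RootedMap.faceDegreeAt, phi_treeMap]
  exact h.face d

theorem planar_treeMap {n : ℕ} {τ m₁ m₂ : Equiv.Perm (Fin n)} (h : TreePair τ m₁ m₂)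
    (hτ : ∀ x y, τ.SameCycle x y) (r : Fin n) : (treeMap h hτ r).Planar := by
  have : Nonempty (Fin n) := ⟨r⟩
  have h1 := h.noncrossing₁
  have h2 := h.noncrossing₂
  have h3 := card_support_add_of_compl h.compl
  rw [Noncrossing, cycleCount_eq_one hτ] at h1 h2
  rw [Fintype.card_fin] at h3
  rw [RootedMap.Planar, RootedMap.faces, phi_treeMap]
  change cycleCount (τ * m₁) + cycleCount (τ * m₂) = n / 2 + 2
  omega

theorem isSpanningTree_treeMap {n : ℕ} {τ m₁ m₂ : Equiv.Perm (Fin n)} (h : TreePair τ m₁ m₂)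
    (hτ : ∀ x y, τ.SameCycle x y) (r : Fin n) :
    (treeMap h hτ r).IsSpanningTree m₁.support := by
  have : Nonempty (Fin n) := ⟨r⟩
  have hcl : ∀ d ∈ m₁.support, (m₁ * m₂) d ∈ m₁.support := fun d hd => by
    rw [Equiv.Perm.mem_support] at hd ⊢
    rw [h.mul_apply_of_ne hd]
    exact h.apply_ne hd
  have key : ∀ d ∈ m₁.support, ∀ x, ∃ s ∈ m₁.support, (τ * m₁).SameCycle s x ∧
      Relation.ReflTransGen (fun a b => a ∈ m₁.support ∧ b ∈ m₁.support ∧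
        ((τ * m₁).SameCycle a b ∨ b = (m₁ * m₂) a)) d s := fun d hd x => by
    refine mem_of_sameCycle (C := fun x => ∃ s ∈ m₁.support, (τ * m₁).SameCycle s x ∧
      Relation.ReflTransGen (fun a b => a ∈ m₁.support ∧ b ∈ m₁.support ∧
        ((τ * m₁).SameCycle a b ∨ b = (m₁ * m₂) a)) d s) ?_ (hτ d x)
      ⟨d, hd, Equiv.Perm.SameCycle.rfl, .refl⟩
    rintro x ⟨s, hs, hsx, hds⟩
    by_cases hx : m₁ x = x
    · have h1 : τ x = (τ * m₁) x := by rw [Equiv.Perm.mul_apply, hx]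
      exact ⟨s, hs, by rwa [h1, Equiv.Perm.sameCycle_apply_right], hds⟩
    · have hxs : x ∈ m₁.support := Equiv.Perm.mem_support.2 hx
      have h1 : τ x = (τ * m₁) (m₁ x) := by
        rw [Equiv.Perm.mul_apply, involution_apply_apply h.sq₁]
      have h2 := hcl x hxs
      refine ⟨(m₁ * m₂) x, h2, ?_, (hds.tail ⟨hs, hxs, Or.inl hsx⟩).tail ⟨hxs, h2, Or.inr rfl⟩⟩
      rw [h1, Equiv.Perm.sameCycle_apply_right, h.mul_apply_of_ne hx]
  have hspan : ∀ d, ∃ d' ∈ m₁.support, (τ * m₁).SameCycle d d' := fun d => by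
    obtain ⟨s, hs⟩ := h.support_nonempty
    obtain ⟨s', hs', h1, -⟩ := key s hs d
    exact ⟨s', hs', h1.symm⟩
  refine ⟨⟨hcl, fun d hd d' hd' => ?_, ?_⟩, hspan⟩
  · obtain ⟨s, hs, h1, h2⟩ := key d hd d'
    exact h2.tail ⟨hs, hd', Or.inl h1⟩
  · have h1 := h.noncrossing₁
    rw [Noncrossing, cycleCount_eq_one hτ] at h1
    have h2 : cycleCount (τ * m₁) = m₁.support.card / 2 + 1 := by omega
    exact (card_quot_subtype_sameCycle hspan).trans h2

end DecoratedMaps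

section ContourWalk

theorem sameCycle_mul_of_tree {β : Type*} [Fintype β] [DecidableEq β] {σ m : Equiv.Perm β}
    (hm : m * m = 1)
    (hC : ∀ C : β → Prop, (∀ x, C x → C (σ x)) → (∀ x, C x → C (m x)) → ∀ x, C x → ∀ y, C y)
    (hcard : 2 * cycleCount σ = m.support.card + 2) (x y : β) : (σ * m).SameCycle x y := by
  induction h : m.support.card using Nat.strong_induction_on generalizing σ m with
  | _ n ih =>
    by_cases hex : ∃ i, ¬ σ.SameCycle i (m i)
    · obtain ⟨i, hi⟩ := hex
      have hmi : m i ≠ i := fun q => hi (by rw [q])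
      have h1 := cycleCount_mul_swap_of_not_sameCycle hi
      have h2 := card_support_involution_mul_swap hm hmi
      have h3 := sameCycle_mul_swap_iff hi
      have h4 : σ * Equiv.swap i (m i) * (m * Equiv.swap i (m i)) = σ * m := by
        rw [Equiv.mul_swap_eq_swap_mul m, involution_apply_apply hm, Equiv.swap_comm (m i) i]
        simp [mul_assoc]
      rw [← h4]
      refine ih _ (by omega) (involution_mul_swap_sq hm i) (fun C hs hc x hx y => ?_) (by omega) rfl
      have h5 : ∀ a b, (σ * Equiv.swap i (m i)).SameCycle a b → C a → C b :=
        fun a b hab ha => mem_of_sameCycle hs hab ha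
      have h6 : (σ * Equiv.swap i (m i)).SameCycle i (m i) := (h3 _ _).2 (Or.inr (Or.inl ⟨.rfl, .rfl⟩))
      refine hC C (fun a ha => h5 a _ ((h3 _ _).2 (Or.inl ?_)) ha) (fun a ha => ?_) x hx y
      · rw [Equiv.Perm.sameCycle_apply_right]
      · by_cases ha1 : a = i
        · subst ha1
          exact h5 _ _ h6 ha
        by_cases ha2 : a = m i
        · subst ha2
          rw [involution_apply_apply hm]
          exact h5 _ _ h6.symm ha
        have := hc a ha
        rwa [involution_mul_swap_apply hm, if_neg (by tauto)] at this
    · push Not at hex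
      have hσ : ∀ x y, σ.SameCycle x y := fun x y =>
        hC (σ.SameCycle x) (fun a ha => Equiv.Perm.sameCycle_apply_right.2 ha)
          (fun a ha => ha.trans (hex a)) x .rfl y
      have : Nonempty β := ⟨x⟩
      rw [cycleCount_eq_one hσ] at hcard
      have hm1 : m = 1 := Equiv.Perm.card_support_eq_zero.1 (by omega)
      rw [hm1, mul_one]
      exact hσ x y

/-- The involution which agrees with `α` on `S` and is the identity elsewhere. -/
def restrictInvolution {β : Type*} [DecidableEq β] (α : Equiv.Perm β) (S : Finset β)
    (hα : ∀ x, α (α x) = x) (hS : ∀ x ∈ S, α x ∈ S) : Equiv.Perm β :=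
  Function.Involutive.toPerm (fun x => if x ∈ S then α x else x) fun x => by
    by_cases hx : x ∈ S
    · simp [hx, hS x hx, hα]
    · simp [hx]

theorem restrictInvolution_apply {β : Type*} [DecidableEq β] {α : Equiv.Perm β} {S : Finset β}
    (hα : ∀ x, α (α x) = x) (hS : ∀ x ∈ S, α x ∈ S) (x : β) :
    restrictInvolution α S hα hS x = if x ∈ S then α x else x := rfl

/-- A spanning-tree decorated planar quadrangulation gives a tree pair with respect to the contour
walk around the tree. -/
theorem exists_treePair {n : ℕ} {M : RootedMap} {S : Finset (Fin M.nd)} (hP : M.Planar)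
    (hQ : M.IsQAngulation 4) (hF : M.faces = n) (hS : M.IsSpanningTree S) :
    M.nd = 4 * n ∧ ∃ τ m₁ m₂ : Equiv.Perm (Fin M.nd), TreePair τ m₁ m₂ ∧
      (∀ x y, τ.SameCycle x y) ∧ M.sigma = τ * m₁ ∧ M.alpha = m₁ * m₂ ∧ m₁.support = S := by
  obtain ⟨⟨hSα, hconn, hquot⟩, hspan⟩ := hS
  have hn : 4 * M.faces = M.nd := (mul_cycleCount_eq_card (π := M.phi) hQ).trans (by simp)
  obtain ⟨m₁, hm₁⟩ : ∃ m₁, m₁ = restrictInvolution M.alpha S M.alpha_invol hSα := ⟨_, rfl⟩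
  have happ : ∀ x, m₁ x = if x ∈ S then M.alpha x else x := fun x => by
    rw [hm₁, restrictInvolution_apply]
  have hinv : ∀ x, m₁ (m₁ x) = x := fun x => by
    rw [happ x]
    by_cases hx : x ∈ S
    · rw [if_pos hx, happ, if_pos (hSα x hx), M.alpha_invol]
    · rw [if_neg hx, happ, if_neg hx]
  have hsq : m₁ * m₁ = 1 := Equiv.ext hinv
  have hsupp : m₁.support = S := by
    ext x
    rw [Equiv.Perm.mem_support, happ]
    by_cases hx : x ∈ S
    · simp [hx, M.alpha_fixfree]
    · simp [hx]
  have happ₂ : ∀ x, (m₁ * M.alpha) x = if x ∈ S then x else M.alpha x := fun x => by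
    rw [Equiv.Perm.mul_apply, happ]
    by_cases hx : x ∈ S
    · rw [if_pos (hSα x hx), if_pos hx, M.alpha_invol]
    · rw [if_neg, if_neg hx]
      intro q
      have := hSα _ q
      rw [M.alpha_invol] at this
      exact hx this
  have hsq₂ : (m₁ * M.alpha) * (m₁ * M.alpha) = 1 := Equiv.ext fun x => by
    rw [Equiv.Perm.mul_apply, happ₂ x]
    by_cases hx : x ∈ S
    · rw [if_pos hx, happ₂, if_pos hx]; rfl
    · have h1 : M.alpha x ∉ S := fun q => hx (by
        have := hSα _ q
        rwa [M.alpha_invol] at this)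
      rw [if_neg hx, happ₂, if_neg h1, M.alpha_invol]; rfl
  have hcompl : ∀ x, m₁ x ≠ x ↔ (m₁ * M.alpha) x = x := fun x => by
    rw [happ₂, ← Equiv.Perm.mem_support, hsupp]
    by_cases hx : x ∈ S <;> simp [hx, M.alpha_fixfree]
  have heven := even_card_support_involution hsq
  rw [hsupp] at heven
  have hV : M.vertices = S.card / 2 + 1 :=
    (card_quot_subtype_sameCycle (σ := M.sigma) hspan).symm.trans hquot
  have hV' : 2 * cycleCount M.sigma = S.card + 2 := by
    change cycleCount M.sigma = _ at hV
    have := heven.two_dvd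
    omega
  have hτ : ∀ x y, (M.sigma * m₁).SameCycle x y := by
    refine sameCycle_mul_of_tree hsq (fun C hs hc x hx y => ?_) (by rw [hsupp, hV'])
    obtain ⟨s, hs1, hs2⟩ := hspan x
    obtain ⟨s', hs1', hs2'⟩ := hspan y
    refine mem_of_sameCycle hs (Equiv.Perm.SameCycle.symm hs2') ?_
    have hreach := hconn s hs1 s' hs1'
    clear hs2' hs1'
    induction hreach with
    | refl => exact mem_of_sameCycle hs hs2 hx
    | tail _ hstep ih =>
      obtain ⟨ha, hb, hab | rfl⟩ := hstep
      · exact mem_of_sameCycle hs hab ih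
      · have := hc _ ih
        rwa [happ, if_pos ha] at this
  have : Nonempty (Fin M.nd) := ⟨M.root⟩
  have hσ : M.sigma = M.sigma * m₁ * m₁ := by rw [mul_assoc, hsq, mul_one]
  have hα : M.alpha = m₁ * (m₁ * M.alpha) := by rw [← mul_assoc, hsq, one_mul]
  have hφ : M.sigma * m₁ * (m₁ * M.alpha) = M.phi := by
    rw [← mul_assoc, ← hσ]; rfl
  have hcards := card_support_add_of_compl hcompl
  rw [hsupp, Fintype.card_fin] at hcards
  have h4 : M.nd = 4 * n := by rw [← hn, hF]
  refine ⟨h4, M.sigma * m₁, m₁, m₁ * M.alpha, ⟨hsq, hsq₂, hcompl, ?_, ?_, ?_⟩, hτ, hσ, hα, hsupp⟩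
  · rw [Noncrossing, ← hσ, hV', hsupp, cycleCount_eq_one hτ]
    omega
  · rw [Noncrossing, hφ, cycleCount_eq_one hτ]
    rw [RootedMap.Planar, hV, RootedMap.edges] at hP
    change _ + cycleCount M.phi = _ at hP
    have := heven.two_dvd
    omega
  · rw [hφ]
    exact hQ

end ContourWalk

section Bijection

theorem cycleCount_conj {β : Type*} (π e : Equiv.Perm β) :
    cycleCount (e * π * e⁻¹) = cycleCount π :=
  Nat.card_congr (Quot.congr e⁻¹ fun _ _ => Equiv.Perm.sameCycle_conj)

theorem cycleLength_conj {β : Type*} (π e : Equiv.Perm β) (x : β) :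
    cycleLength (e * π * e⁻¹) x = cycleLength π (e⁻¹ x) :=
  Nat.card_congr (Equiv.subtypeEquiv e⁻¹ fun _ => Equiv.Perm.sameCycle_conj)

theorem noncrossing_conj {β : Type*} [Fintype β] [DecidableEq β] {τ m : Equiv.Perm β}
    (h : Noncrossing τ m) (e : Equiv.Perm β) : Noncrossing (e * τ * e⁻¹) (e * m * e⁻¹) := by
  have h1 : e * τ * e⁻¹ * (e * m * e⁻¹) = e * (τ * m) * e⁻¹ := by simp [mul_assoc]
  rw [Noncrossing, h1, cycleCount_conj, cycleCount_conj, Equiv.Perm.card_support_conj]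
  exact h

theorem TreePair.conj {β : Type*} [Fintype β] [DecidableEq β] {τ m₁ m₂ : Equiv.Perm β}
    (h : TreePair τ m₁ m₂) (e : Equiv.Perm β) :
    TreePair (e * τ * e⁻¹) (e * m₁ * e⁻¹) (e * m₂ * e⁻¹) where
  sq₁ := by
    have : e * m₁ * e⁻¹ * (e * m₁ * e⁻¹) = e * (m₁ * m₁) * e⁻¹ := by simp [mul_assoc]
    rw [this, h.sq₁, mul_one, mul_inv_cancel]
  sq₂ := by
    have : e * m₂ * e⁻¹ * (e * m₂ * e⁻¹) = e * (m₂ * m₂) * e⁻¹ := by simp [mul_assoc]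
    rw [this, h.sq₂, mul_one, mul_inv_cancel]
  compl x := by
    have := h.compl (e⁻¹ x)
    simp only [Equiv.Perm.mul_apply, ne_eq, ← Equiv.Perm.eq_inv_iff_eq] at this ⊢
    exact this
  noncrossing₁ := noncrossing_conj h.noncrossing₁ e
  noncrossing₂ := noncrossing_conj h.noncrossing₂ e
  face x := by
    have : e * τ * e⁻¹ * (e * m₂ * e⁻¹) = e * (τ * m₂) * e⁻¹ := by simp [mul_assoc]
    rw [this, cycleLength_conj]
    exact h.face _

theorem exists_conj_eq_of_sameCycle {β : Type*} [Fintype β] [DecidableEq β] [Nontrivial β]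
    {τ τ' : Equiv.Perm β} (h : ∀ x y, τ.SameCycle x y) (h' : ∀ x y, τ'.SameCycle x y) (a b : β) :
    ∃ e : Equiv.Perm β, e * τ * e⁻¹ = τ' ∧ e a = b := by
  have hne : ∀ {ρ : Equiv.Perm β}, (∀ x y, ρ.SameCycle x y) → ∀ x, ρ x ≠ x := by
    intro ρ hρ x hx
    obtain ⟨y, hy⟩ := exists_ne x
    exact hy ((hρ x y).eq_of_left hx).symm
  have hcyc : ∀ {ρ : Equiv.Perm β}, (∀ x y, ρ.SameCycle x y) →
      ρ.IsCycle ∧ ρ.support = Finset.univ := fun {ρ} hρ =>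
    ⟨⟨a, hne hρ a, fun y _ => hρ a y⟩, Finset.eq_univ_iff_forall.2 fun x =>
      Equiv.Perm.mem_support.2 (hne hρ x)⟩
  obtain ⟨c, hc⟩ := isConj_iff.1
    ((hcyc h).1.isConj (hcyc h').1 (by rw [(hcyc h).2, (hcyc h').2]))
  obtain ⟨k, hk⟩ := h' (c a) b
  refine ⟨τ' ^ k * c, ?_, hk⟩
  rw [mul_inv_rev, mul_assoc, mul_assoc, ← mul_assoc τ, ← mul_assoc c, ← mul_assoc c, hc,
    ← zpow_neg, ← zpow_one_add, ← zpow_add]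
  simp

/-- Spanning-tree decorated rooted quadrangulations with `n` faces. -/
abbrev DecoratedQuadrangulation (n : ℕ) :=
  {P : Σ M : RootedMap, Finset (Fin M.nd) //
    P.1.Planar ∧ P.1.IsQAngulation 4 ∧ P.1.faces = n ∧ P.1.IsSpanningTree P.2}

theorem decIso_equivalence (n : ℕ) : Equivalence fun P₁ P₂ : DecoratedQuadrangulation n =>
    RootedMap.DecIso P₁.1.1 P₂.1.1 P₁.1.2 P₂.1.2 where
  refl _ := ⟨Equiv.refl _, fun _ => rfl, fun _ => rfl, rfl, fun _ => Iff.rfl⟩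
  symm := by
    rintro P₁ P₂ ⟨f, h1, h2, h3, h4⟩
    refine ⟨f.symm, fun d => ?_, fun d => ?_, ?_, fun d => ?_⟩
    · rw [Equiv.symm_apply_eq, h1, f.apply_symm_apply]
    · rw [Equiv.symm_apply_eq, h2, f.apply_symm_apply]
    · rw [Equiv.symm_apply_eq, h3]
    · rw [h4, f.apply_symm_apply]
  trans := by
    rintro P₁ P₂ P₃ ⟨f, h1, h2, h3, h4⟩ ⟨f', h1', h2', h3', h4'⟩
    exact ⟨f.trans f', fun d => by simp [h1, h1'], fun d => by simp [h2, h2'],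
      by simp [h3, h3'], fun d => by simp [h4, h4']⟩

theorem TreePair.mul_apply {β : Type*} [Fintype β] [DecidableEq β] {τ m₁ m₂ : Equiv.Perm β}
    (h : TreePair τ m₁ m₂) (x : β) :
    m₁ x = if x ∈ m₁.support then (m₁ * m₂) x else x := by
  split_ifs with hx
  · rw [h.mul_apply_of_ne (Equiv.Perm.mem_support.1 hx)]
  · exact Equiv.Perm.notMem_support.1 hx

theorem eq_of_decIso_treeMap {n : ℕ} {τ m₁ m₂ m₁' m₂' : Equiv.Perm (Fin n)}
    (h : TreePair τ m₁ m₂) (h' : TreePair τ m₁' m₂') (hτ : ∀ x y, τ.SameCycle x y) {r : Fin n}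
    (hiso : (treeMap h hτ r).DecIso (treeMap h' hτ r) m₁.support m₁'.support) :
    m₁ = m₁' ∧ m₂ = m₂' := by
  obtain ⟨f, hσ, hα, hr, hS⟩ := hiso
  change Equiv.Perm (Fin n) at f
  change ∀ d, f ((τ * m₁) d) = (τ * m₁') (f d) at hσ
  change ∀ d, f ((m₁ * m₂) d) = (m₁' * m₂') (f d) at hα
  change f r = r at hr
  change ∀ d : Fin n, d ∈ m₁.support ↔ f d ∈ m₁'.support at hS
  have hm : ∀ d, f (m₁ d) = m₁' (f d) := fun d => by
    rw [h.mul_apply, h'.mul_apply]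
    by_cases hd : d ∈ m₁.support
    · rw [if_pos hd, if_pos ((hS d).1 hd), hα]
    · rw [if_neg hd, if_neg (fun q => hd ((hS d).2 q))]
  have hf : ∀ d, f d = d := fun d => by
    refine mem_of_sameCycle (C := fun x => f x = x) (fun x hx => ?_) (hτ r d) hr
    have h1 := hσ (m₁ x)
    rw [hm, hx, Equiv.Perm.mul_apply, Equiv.Perm.mul_apply, involution_apply_apply h.sq₁,
      involution_apply_apply h'.sq₁] at h1
    exact h1
  have h1 : m₁ = m₁' := Equiv.ext fun x => by rw [← hf (m₁ x), hm, hf]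
  have h2 : m₁ * m₂ = m₁' * m₂' := Equiv.ext fun x => by rw [← hf ((m₁ * m₂) x), hα, hf]
  rw [← h1] at h2
  exact ⟨h1, mul_left_cancel h2⟩

theorem exists_decIso_treeMap {n : ℕ} [Nontrivial (Fin n)] {τ : Equiv.Perm (Fin n)}
    (hτ : ∀ x y, τ.SameCycle x y) (r : Fin n) {M : RootedMap} (hM : M.nd = n)
    {S : Finset (Fin M.nd)} {τ' m₁ m₂ : Equiv.Perm (Fin M.nd)} (h : TreePair τ' m₁ m₂)
    (hτ' : ∀ x y, τ'.SameCycle x y) (hσ : M.sigma = τ' * m₁) (hα : M.alpha = m₁ * m₂)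
    (hS : m₁.support = S) :
    ∃ m₁' m₂' : Equiv.Perm (Fin n), ∃ h' : TreePair τ m₁' m₂',
      (treeMap h' hτ r).DecIso M m₁'.support S := by
  subst hM
  obtain ⟨e, he, hr⟩ := exists_conj_eq_of_sameCycle hτ' hτ M.root r
  have h' := h.conj e
  rw [he] at h'
  refine ⟨_, _, h', (e⁻¹ : Equiv.Perm (Fin M.nd)), fun (d : Fin M.nd) => ?_,
    fun (d : Fin M.nd) => ?_, ?_, fun (d : Fin M.nd) => ?_⟩
  · change e⁻¹ ((τ * (e * m₁ * e⁻¹)) d) = M.sigma (e⁻¹ d)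
    rw [hσ, ← he]
    simp
  · change e⁻¹ ((e * m₁ * e⁻¹ * (e * m₂ * e⁻¹)) d) = M.alpha (e⁻¹ d)
    rw [hα]
    simp
  · change e⁻¹ r = M.root
    rw [Equiv.Perm.inv_eq_iff_eq, hr]
  · change d ∈ (e * m₁ * e⁻¹).support ↔ e⁻¹ d ∈ S
    rw [← hS, Equiv.Perm.mem_support, Equiv.Perm.mem_support]
    simp [← Equiv.Perm.eq_inv_iff_eq]

theorem card_decoratedQuadrangulation_succ (g : ℕ) :
    Nat.card (Quot fun P₁ P₂ : DecoratedQuadrangulation (g + 1) =>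
      RootedMap.DecIso P₁.1.1 P₂.1.1 P₁.1.2 P₂.1.2) =
    Nat.card {p : Equiv.Perm (Fin (4 * g + 3 + 1)) × Equiv.Perm (Fin (4 * g + 3 + 1)) //
      TreePair (downCycle (4 * g + 3) (4 * g + 3)) p.1 p.2} := by
  have hτ := sameCycle_downCycle (4 * g + 3)
  have hfaces : ∀ {m₁ m₂} (h : TreePair (downCycle (4 * g + 3) (4 * g + 3)) m₁ m₂),
      (treeMap h hτ 0).faces = g + 1 := fun h => by
    have := four_mul_faces_treeMap h hτ 0
    omega
  symm
  refine Nat.card_eq_of_bijective (fun p => Quot.mk _ ⟨⟨treeMap p.2 hτ 0, p.1.1.support⟩,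
    planar_treeMap p.2 hτ 0, isQAngulation_treeMap p.2 hτ 0, hfaces p.2,
    isSpanningTree_treeMap p.2 hτ 0⟩) ⟨fun p p' hpp => ?_, fun q => ?_⟩
  · have hiso := ((decIso_equivalence (g + 1)).quot_mk_eq_iff _ _).1 hpp
    obtain ⟨h1, h2⟩ := eq_of_decIso_treeMap p.2 p'.2 hτ hiso
    exact Subtype.ext (Prod.ext h1 h2)
  · obtain ⟨⟨⟨M, S⟩, hP, hQ, hF, hS⟩, rfl⟩ := Quot.exists_rep q
    obtain ⟨hn, τ', m₁, m₂, h, hτ', hσ, hα, hsupp⟩ := exists_treePair hP hQ hF hS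
    obtain ⟨m₁', m₂', h', hiso⟩ := exists_decIso_treeMap hτ 0 (by omega) h hτ' hσ hα hsupp
    exact ⟨⟨(m₁', m₂'), h'⟩, Quot.sound hiso⟩

theorem isEmpty_decoratedQuadrangulation_zero : IsEmpty (DecoratedQuadrangulation 0) := by
  refine ⟨fun P => ?_⟩
  obtain ⟨⟨M, S⟩, -, -, hF, -⟩ := P
  have : Nonempty (Quot M.phi.SameCycle) := ⟨Quot.mk _ M.root⟩
  exact (Nat.card_pos (α := Quot M.phi.SameCycle)).ne' hF

end Bijection

/-- The number of spanning-tree decorated rooted quadrangulations with `f` faces (the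
root-edge may be any oriented edge of the map, the spanning tree is unrooted) equals
`4f/((f+1)²(f+2)) · (3f)!/(f!)³`. -/
theorem card_spanning_tree_quadrangulations (f : ℕ) :
    (Nat.card (Quot (fun P₁ P₂ :
        {P : Σ M : RootedMap, Finset (Fin M.nd) //
          P.1.Planar ∧ P.1.IsQAngulation 4 ∧ P.1.faces = f ∧ P.1.IsSpanningTree P.2} =>
        RootedMap.DecIso P₁.1.1 P₂.1.1 P₁.1.2 P₂.1.2)) : ℚ)
      = (4 * f : ℚ) / ((f + 1) ^ 2 * (f + 2))
        * ((3 * f).factorial : ℚ) / ((f.factorial : ℚ)) ^ 3 := by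
  cases f with
  | zero =>
    have := isEmpty_decoratedQuadrangulation_zero
    rw [Nat.card_of_isEmpty]
    simp
  | succ g =>
    have h1 := card_treePair g
    rw [← card_decoratedQuadrangulation_succ] at h1
    have h2 : _ = _ := congrArg (Nat.cast (R := ℚ)) h1
    push_cast at h2 ⊢
    rw [← eq_div_iff (by positivity)] at h2
    rw [h2, show 3 * (g + 1) = 3 * g + 3 by ring, Nat.factorial_succ (g + 2),
      Nat.factorial_succ (g + 1), Nat.factorial_succ g]
    have := Nat.factorial_pos g
    push_cast
    field_simp
    ring
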